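/- arXiv:2204.01060 — 17 statements merged into one kernel-verified Lean document; each statement's English description precedes it below -/
import Mathlib

section
/- Let 0 → h_S →^i e_U →^p g_T → 0 be a non-abelian extension of Rota-Baxter Lie algebras and let s : g → e be a section of p, with induced maps χ, ψ, Φ. Then for all x ∈ g and h ∈ h one has ψ_{T(x)}(S(h)) = S(ψ_x(S(h)) + ψ_{T(x)}(h)) + S([Φ(x), h]_h) − [Φ(x), S(h)]_h. -/
/-- For a non-abelian extension of Rota-Baxter Lie algebras with a
section `s` and induced maps `χ`, `ψ`, `Φ`, condition (III) of a non-abelian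
2-cocycle holds. Here `h` is identified with its image in `e` via `i`, and the
induced maps are characterized through `i`. -/
theorem stmt0
    {k g h e : Type*} [Field k] [CharZero k]
    [LieRing g] [LieAlgebra k g] [LieRing h] [LieAlgebra k h]
    [LieRing e] [LieAlgebra k e]
    (T : g →ₗ[k] g) (S : h →ₗ[k] h) (U : e →ₗ[k] e)
    (hT : ∀ x y : g, ⁅T x, T y⁆ = T (⁅T x, y⁆ + ⁅x, T y⁆))
    (hS : ∀ a b : h, ⁅S a, S b⁆ = S (⁅S a, b⁆ + ⁅a, S b⁆))
    (hU : ∀ u v : e, ⁅U u, U v⁆ = U (⁅U u, v⁆ + ⁅u, U v⁆))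
    (i : h →ₗ⁅k⁆ e) (p : e →ₗ⁅k⁆ g)
    (hi : Function.Injective i) (hp : Function.Surjective p)
    (hiU : ∀ a : h, U (i a) = i (S a))
    (hpU : ∀ v : e, p (U v) = T (p v))
    (hexact : ∀ v : e, p v = 0 ↔ ∃ a : h, i a = v)
    (s : g →ₗ[k] e) (hs : ∀ x : g, p (s x) = x)
    (χ : g → g → h) (ψ : g → h → h) (Φ : g → h)
    (hχ : ∀ x y : g, i (χ x y) = ⁅s x, s y⁆ - s ⁅x, y⁆)
    (hψ : ∀ (x : g) (a : h), i (ψ x a) = ⁅s x, i a⁆)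
    (hΦ : ∀ x : g, i (Φ x) = U (s x) - s (T x)) :
    ∀ (x : g) (a : h),
      ψ (T x) (S a) = S (ψ x (S a) + ψ (T x) a) + S ⁅Φ x, a⁆ - ⁅Φ x, S a⁆ := by
  intro x a
  have hUs : U (s x) = s (T x) + i (Φ x) := by rw [hΦ]; abel
  have key := hU (s x) (i a)
  rw [hiU, hUs, add_lie, add_lie, ← hψ, ← hψ, ← hψ, ← LieHom.map_lie, ← LieHom.map_lie,
    ← map_add, ← map_add, ← map_add, hiU] at key
  have hcancel := hi key
  rw [eq_sub_iff_add_eq, hcancel, ← map_add]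
  congr 1
  abel
end

section
/- Let 0 → h_S →^i e_U →^p g_T → 0 be a non-abelian extension of Rota-Baxter Lie algebras and let s : g → e be a section of p, with induced maps χ, ψ, Φ. Then for all x, y ∈ g one has χ(T(x), T(y)) − S(χ(x, T(y)) + χ(T(x), y)) − Φ([x, T(y)]_g + [T(x), y]_g) + ψ_{T(x)}(Φ(y)) − ψ_{T(y)}(Φ(x)) − S(ψ_x(Φ(y)) − ψ_y(Φ(x))) + [Φ(x), Φ(y)]_h = 0. -/
/-- condition (IV) of a non-abelian 2-cocycle holds for the triple
induced by a section of a non-abelian extension of Rota-Baxter Lie algebras. -/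
theorem stmt1
    {k g h e : Type*} [Field k] [CharZero k]
    [LieRing g] [LieAlgebra k g] [LieRing h] [LieAlgebra k h]
    [LieRing e] [LieAlgebra k e]
    (T : g →ₗ[k] g) (S : h →ₗ[k] h) (U : e →ₗ[k] e)
    (hT : ∀ x y : g, ⁅T x, T y⁆ = T (⁅T x, y⁆ + ⁅x, T y⁆))
    (hS : ∀ a b : h, ⁅S a, S b⁆ = S (⁅S a, b⁆ + ⁅a, S b⁆))
    (hU : ∀ u v : e, ⁅U u, U v⁆ = U (⁅U u, v⁆ + ⁅u, U v⁆))
    (i : h →ₗ⁅k⁆ e) (p : e →ₗ⁅k⁆ g)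
    (hi : Function.Injective i) (hp : Function.Surjective p)
    (hiU : ∀ a : h, U (i a) = i (S a))
    (hpU : ∀ v : e, p (U v) = T (p v))
    (hexact : ∀ v : e, p v = 0 ↔ ∃ a : h, i a = v)
    (s : g →ₗ[k] e) (hs : ∀ x : g, p (s x) = x)
    (χ : g → g → h) (ψ : g → h → h) (Φ : g → h)
    (hχ : ∀ x y : g, i (χ x y) = ⁅s x, s y⁆ - s ⁅x, y⁆)
    (hψ : ∀ (x : g) (a : h), i (ψ x a) = ⁅s x, i a⁆)
    (hΦ : ∀ x : g, i (Φ x) = U (s x) - s (T x)) :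
    ∀ x y : g,
      χ (T x) (T y) - S (χ x (T y) + χ (T x) y) - Φ (⁅x, T y⁆ + ⁅T x, y⁆)
        + ψ (T x) (Φ y) - ψ (T y) (Φ x) - S (ψ x (Φ y) - ψ y (Φ x))
        + ⁅Φ x, Φ y⁆ = 0 := by
  intro x y
  have hUs : ∀ z, U (s z) = s (T z) + i (Φ z) := fun z => by rw [hΦ]; abel
  have key := hU (s x) (s y)
  have hsum : ⁅U (s x), s y⁆ + ⁅s x, U (s y)⁆ =
      s (⁅x, T y⁆ + ⁅T x, y⁆) + i (χ x (T y) + χ (T x) y)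
        + i (ψ x (Φ y) - ψ y (Φ x)) := by
    simp only [map_add, map_sub, hχ, hψ, hUs, add_lie, lie_add]
    rw [← lie_skew (s y) (i (Φ x))]
    abel
  rw [hsum, map_add, map_add, hUs x, hUs y, hUs (_ + _), hiU, hiU, add_comm ⁅x, T y⁆,
    ← hT, add_comm ⁅T x, y⁆] at key
  simp only [add_lie, lie_add] at key
  rw [← sub_eq_zero] at key
  apply hi
  rw [map_zero, map_add, map_sub, map_sub, map_add, map_sub, map_sub, LieHom.map_lie,
    hχ, hψ, hψ]
  refine Eq.trans ?_ key
  rw [← lie_skew (i (Φ x)) (s (T y))]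
  abel
end

section
/- Let 0 → h_S →^i e_U →^p g_T → 0 be a non-abelian extension of Rota-Baxter Lie algebras. Let s and s' be two sections of p with induced triples (χ, ψ, Φ) and (χ', ψ', Φ'), and set φ(x) = s(x) − s'(x) (which takes values in h). Then for all x, y ∈ g and h ∈ h: ψ_x(h) − ψ'_x(h) = [φ(x), h]_h; χ(x,y) − χ'(x,y) = ψ'_x(φ(y)) − ψ'_y(φ(x)) − φ([x,y]_g) + [φ(x), φ(y)]_h; and Φ(x) − Φ'(x) = S(φ(x)) − φ(T(x)). -/
/-- how the induced triple of a non-abelian extension changes when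
the section is changed; the difference is controlled by φ = s − s'. -/
theorem stmt2
    {k g h e : Type*} [Field k] [CharZero k]
    [LieRing g] [LieAlgebra k g] [LieRing h] [LieAlgebra k h]
    [LieRing e] [LieAlgebra k e]
    (T : g →ₗ[k] g) (S : h →ₗ[k] h) (U : e →ₗ[k] e)
    (hT : ∀ x y : g, ⁅T x, T y⁆ = T (⁅T x, y⁆ + ⁅x, T y⁆))
    (hS : ∀ a b : h, ⁅S a, S b⁆ = S (⁅S a, b⁆ + ⁅a, S b⁆))
    (hU : ∀ u v : e, ⁅U u, U v⁆ = U (⁅U u, v⁆ + ⁅u, U v⁆))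
    (i : h →ₗ⁅k⁆ e) (p : e →ₗ⁅k⁆ g)
    (hi : Function.Injective i) (hp : Function.Surjective p)
    (hiU : ∀ a : h, U (i a) = i (S a))
    (hpU : ∀ v : e, p (U v) = T (p v))
    (hexact : ∀ v : e, p v = 0 ↔ ∃ a : h, i a = v)
    (s : g →ₗ[k] e) (hs : ∀ x : g, p (s x) = x)
    (χ : g → g → h) (ψ : g → h → h) (Φ : g → h)
    (hχ : ∀ x y : g, i (χ x y) = ⁅s x, s y⁆ - s ⁅x, y⁆)
    (hψ : ∀ (x : g) (a : h), i (ψ x a) = ⁅s x, i a⁆)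
    (hΦ : ∀ x : g, i (Φ x) = U (s x) - s (T x))
    (s' : g →ₗ[k] e) (hs' : ∀ x : g, p (s' x) = x)
    (χ' : g → g → h) (ψ' : g → h → h) (Φ' : g → h)
    (hχ' : ∀ x y : g, i (χ' x y) = ⁅s' x, s' y⁆ - s' ⁅x, y⁆)
    (hψ' : ∀ (x : g) (a : h), i (ψ' x a) = ⁅s' x, i a⁆)
    (hΦ' : ∀ x : g, i (Φ' x) = U (s' x) - s' (T x))
    (φ : g → h) (hφ : ∀ x : g, i (φ x) = s x - s' x) :
    (∀ (x : g) (a : h), ψ x a - ψ' x a = ⁅φ x, a⁆) ∧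
    (∀ x y : g,
      χ x y - χ' x y = ψ' x (φ y) - ψ' y (φ x) - φ ⁅x, y⁆ + ⁅φ x, φ y⁆) ∧
    (∀ x : g, Φ x - Φ' x = S (φ x) - φ (T x)) := by
  refine ⟨fun x a => hi ?_, fun x y => hi ?_, fun x => hi ?_⟩
  · simp only [map_sub, LieHom.map_lie, hψ, hψ', hφ, sub_lie]
  · simp only [map_sub, map_add, LieHom.map_lie, hχ, hχ', hψ', hφ, sub_lie, lie_sub]
    rw [← lie_skew (s x) (s' y), ← lie_skew (s' x) (s' y)]
    abel
  · simp only [map_sub, ← hiU, hΦ, hΦ', hφ]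
    abel
end

section
/- Let 0 → h_S →^i e_U →^p g_T → 0 and 0 → h_S →^{i'} e'_{U'} →^{p'} g_T → 0 be two non-abelian extensions of g_T by h_S that are equivalent via a morphism of Rota-Baxter Lie algebras φ : e_U → e'_{U'} satisfying φ∘i = i' and p'∘φ = p. Let s be a section of p. Then s' = φ∘s is a section of p', and the induced triple (χ', ψ', Φ') of the extension e'_{U'} with respect to the section s' is equal to the induced triple (χ, ψ, Φ) of the extension e_U with respect to s. -/
/-- for equivalent non-abelian extensions of Rota-Baxter Lie
algebras related by a morphism φm, the composite s' = φm ∘ s is a section of p'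
and the induced triples coincide. -/
theorem stmt3
    {k g h e e' : Type*} [Field k] [CharZero k]
    [LieRing g] [LieAlgebra k g] [LieRing h] [LieAlgebra k h]
    [LieRing e] [LieAlgebra k e] [LieRing e'] [LieAlgebra k e']
    (T : g →ₗ[k] g) (S : h →ₗ[k] h) (U : e →ₗ[k] e) (U' : e' →ₗ[k] e')
    (hT : ∀ x y : g, ⁅T x, T y⁆ = T (⁅T x, y⁆ + ⁅x, T y⁆))
    (hS : ∀ a b : h, ⁅S a, S b⁆ = S (⁅S a, b⁆ + ⁅a, S b⁆))
    (hU : ∀ u v : e, ⁅U u, U v⁆ = U (⁅U u, v⁆ + ⁅u, U v⁆))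
    (hU' : ∀ u v : e', ⁅U' u, U' v⁆ = U' (⁅U' u, v⁆ + ⁅u, U' v⁆))
    (i : h →ₗ⁅k⁆ e) (p : e →ₗ⁅k⁆ g)
    (hi : Function.Injective i) (hp : Function.Surjective p)
    (hiU : ∀ a : h, U (i a) = i (S a))
    (hpU : ∀ v : e, p (U v) = T (p v))
    (hexact : ∀ v : e, p v = 0 ↔ ∃ a : h, i a = v)
    (i' : h →ₗ⁅k⁆ e') (p' : e' →ₗ⁅k⁆ g)
    (hi' : Function.Injective i') (hp' : Function.Surjective p')
    (hiU' : ∀ a : h, U' (i' a) = i' (S a))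
    (hpU' : ∀ v : e', p' (U' v) = T (p' v))
    (hexact' : ∀ v : e', p' v = 0 ↔ ∃ a : h, i' a = v)
    (φm : e →ₗ⁅k⁆ e')
    (hφU : ∀ v : e, φm (U v) = U' (φm v))
    (hφi : ∀ a : h, φm (i a) = i' a)
    (hφp : ∀ v : e, p' (φm v) = p v)
    (s : g →ₗ[k] e) (hs : ∀ x : g, p (s x) = x)
    (χ : g → g → h) (ψ : g → h → h) (Φ : g → h)
    (hχ : ∀ x y : g, i (χ x y) = ⁅s x, s y⁆ - s ⁅x, y⁆)
    (hψ : ∀ (x : g) (a : h), i (ψ x a) = ⁅s x, i a⁆)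
    (hΦ : ∀ x : g, i (Φ x) = U (s x) - s (T x))
    (χ' : g → g → h) (ψ' : g → h → h) (Φ' : g → h)
    (hχ' : ∀ x y : g, i' (χ' x y) = ⁅φm (s x), φm (s y)⁆ - φm (s ⁅x, y⁆))
    (hψ' : ∀ (x : g) (a : h), i' (ψ' x a) = ⁅φm (s x), i' a⁆)
    (hΦ' : ∀ x : g, i' (Φ' x) = U' (φm (s x)) - φm (s (T x))) :
    (∀ x : g, p' (φm (s x)) = x) ∧
    (∀ x y : g, χ' x y = χ x y) ∧
    (∀ (x : g) (a : h), ψ' x a = ψ x a) ∧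
    (∀ x : g, Φ' x = Φ x) := by
  refine ⟨fun x => by rw [hφp, hs], fun x y => hi' ?_, fun x a => hi' ?_, fun x => hi' ?_⟩
  · rw [hχ', ← hφi, hχ, map_sub, LieHom.map_lie]
  · rw [hψ', ← hφi (ψ x a), hψ, LieHom.map_lie, hφi]
  · rw [hΦ', ← hφi, hΦ, map_sub, hφU]
end

section
/- Let g_T and h_S be Rota-Baxter Lie algebras and let (χ, ψ, Φ) be a non-abelian 2-cocycle of g_T with values in h_S. Then the vector space g ⊕ h with the bracket [(x,h), (y,k)]_{χ,ψ} = ([x,y]_g, ψ_x(k) − ψ_y(h) + χ(x,y) + [h,k]_h) is a Lie algebra, and the linear map U_Φ(x,h) = (T(x), S(h) + Φ(x)) is a Rota-Baxter operator on this Lie algebra. -/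
/-- a non-abelian 2-cocycle (χ, ψ, Φ) of a Rota-Baxter Lie algebra
g_T with values in h_S gives a Lie algebra structure on g ⊕ h, and U_Φ is a
Rota-Baxter operator on it. -/
theorem stmt4
    {k g h : Type*} [Field k] [CharZero k]
    [LieRing g] [LieAlgebra k g] [LieRing h] [LieAlgebra k h]
    (T : g →ₗ[k] g) (S : h →ₗ[k] h)
    (hT : ∀ x y : g, ⁅T x, T y⁆ = T (⁅T x, y⁆ + ⁅x, T y⁆))
    (hS : ∀ a b : h, ⁅S a, S b⁆ = S (⁅S a, b⁆ + ⁅a, S b⁆))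
    (χ : g →ₗ[k] g →ₗ[k] h) (ψ : g →ₗ[k] h →ₗ[k] h) (Φ : g →ₗ[k] h)
    (hχalt : ∀ x : g, χ x x = 0)
    (hψder : ∀ (x : g) (a b : h), ψ x ⁅a, b⁆ = ⁅ψ x a, b⁆ + ⁅a, ψ x b⁆)
    (c1 : ∀ (x y : g) (a : h),
      ψ x (ψ y a) - ψ y (ψ x a) - ψ ⁅x, y⁆ a = ⁅χ x y, a⁆)
    (c2 : ∀ x y z : g,
      ψ x (χ y z) + ψ y (χ z x) + ψ z (χ x y)
        - χ ⁅x, y⁆ z - χ ⁅y, z⁆ x - χ ⁅z, x⁆ y = 0)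
    (c3 : ∀ (x : g) (a : h),
      ψ (T x) (S a) = S (ψ x (S a) + ψ (T x) a) + S ⁅Φ x, a⁆ - ⁅Φ x, S a⁆)
    (c4 : ∀ x y : g,
      χ (T x) (T y) - S (χ x (T y) + χ (T x) y) - Φ (⁅x, T y⁆ + ⁅T x, y⁆)
        + ψ (T x) (Φ y) - ψ (T y) (Φ x) - S (ψ x (Φ y) - ψ y (Φ x))
        + ⁅Φ x, Φ y⁆ = 0) :
    ∀ B : g × h → g × h → g × h,
      (∀ u v : g × h,
        B u v = (⁅u.1, v.1⁆, ψ u.1 v.2 - ψ v.1 u.2 + χ u.1 v.1 + ⁅u.2, v.2⁆)) →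
      ∀ UΦ : g × h → g × h,
        (∀ u : g × h, UΦ u = (T u.1, S u.2 + Φ u.1)) →
        (∀ u v w : g × h, B (u + v) w = B u w + B v w) ∧
        (∀ (c : k) (u v : g × h), B (c • u) v = c • B u v) ∧
        (∀ u v w : g × h, B u (v + w) = B u v + B u w) ∧
        (∀ (c : k) (u v : g × h), B u (c • v) = c • B u v) ∧
        (∀ u : g × h, B u u = 0) ∧
        (∀ u v w : g × h, B (B u v) w + B (B v w) u + B (B w u) v = 0) ∧
        (∀ u v : g × h, B (UΦ u) (UΦ v) = UΦ (B (UΦ u) v + B u (UΦ v))) := by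
  have skew : ∀ a b : h, ⁅a, b⁆ + ⁅b, a⁆ = 0 := fun a b ↦ by
    rw [← lie_skew, neg_add_cancel]
  intro B hB UΦ hU
  refine ⟨fun u v w ↦ ?_, fun c u v ↦ ?_, fun u v w ↦ ?_, fun c u v ↦ ?_, fun u ↦ ?_,
    fun u v w ↦ ?_, fun u v ↦ ?_⟩
  · ext <;> simp [hB]
    abel
  · ext <;> simp [hB, smul_sub]
  · ext <;> simp [hB]
    abel
  · ext <;> simp [hB, smul_sub]
  · ext <;> simp [hB, hχalt]
  · obtain ⟨x, a⟩ := u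
    obtain ⟨y, b⟩ := v
    obtain ⟨z, c⟩ := w
    ext
    · simp only [hB, Prod.fst_add, Prod.fst_zero]
      rw [← lie_skew ⁅x, y⁆ z, ← lie_skew ⁅y, z⁆ x, ← lie_skew ⁅z, x⁆ y]
      linear_combination (norm := module) (-1 : ℤ) • lie_jacobi x y z
    · simp only [hB, Prod.snd_add, Prod.snd_zero, map_add, map_sub, hψder, add_lie, sub_lie]
      linear_combination (norm := module) (-1 : ℤ) • c1 x y c + (-1 : ℤ) • c1 y z a
        + (-1 : ℤ) • c1 z x b + (-1 : ℤ) • c2 x y z + (-1 : ℤ) • lie_jacobi a b c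
        + skew ⁅a, b⁆ c + skew ⁅b, c⁆ a + skew ⁅c, a⁆ b
        + (-1 : ℤ) • skew a (ψ z b) + (-1 : ℤ) • skew b (ψ x c) + (-1 : ℤ) • skew c (ψ y a)
  · obtain ⟨x, a⟩ := u
    obtain ⟨y, b⟩ := v
    have c3x := c3 x b
    have c3y := c3 y a
    have c4' := c4 x y
    have hSab := hS a b
    have hskew := congrArg S (skew a (Φ y))
    simp only [map_add, map_sub, map_zero] at c3x c3y c4' hSab hskew
    ext
    · simp only [hB, hU, Prod.fst_add, hT]
    · simp only [hB, hU, Prod.fst_add, Prod.snd_add, map_add, map_sub, add_lie, lie_add]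
      linear_combination (norm := module) c3x - c3y + c4' + hSab - hskew + skew (S a) (Φ y)
end

section
/- Let g_T and h_S be Rota-Baxter Lie algebras and let (χ, ψ, Φ) and (χ', ψ', Φ') be two non-abelian 2-cocycles of g_T with values in h_S that are equivalent via a linear map φ : g → h. Then the map Θ : g ⊕ h → g ⊕ h, Θ(x,h) = (x, φ(x) + h), is a bijective Lie algebra homomorphism from (g ⊕_{χ,ψ} h, [·,·]_{χ,ψ}) to (g ⊕_{χ',ψ'} h, [·,·]_{χ',ψ'}) satisfying U_{Φ'}∘Θ = Θ∘U_Φ; hence Θ defines an equivalence of the two non-abelian extensions (g ⊕_{χ,ψ} h)_{U_Φ} and (g ⊕_{χ',ψ'} h)_{U_{Φ'}} of g_T by h_S. -/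
/-- equivalent non-abelian 2-cocycles give equivalent non-abelian
extensions; the map Θ(x,a) = (x, φ(x)+a) is a bijective Lie algebra
homomorphism between the induced Rota-Baxter Lie algebra structures on g ⊕ h,
intertwining the Rota-Baxter operators. -/
theorem stmt5
    {k g h : Type*} [Field k] [CharZero k]
    [LieRing g] [LieAlgebra k g] [LieRing h] [LieAlgebra k h]
    (T : g →ₗ[k] g) (S : h →ₗ[k] h)
    (hT : ∀ x y : g, ⁅T x, T y⁆ = T (⁅T x, y⁆ + ⁅x, T y⁆))
    (hS : ∀ a b : h, ⁅S a, S b⁆ = S (⁅S a, b⁆ + ⁅a, S b⁆))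
    (χ : g →ₗ[k] g →ₗ[k] h) (ψ : g →ₗ[k] h →ₗ[k] h) (Φ : g →ₗ[k] h)
    (hχalt : ∀ x : g, χ x x = 0)
    (hψder : ∀ (x : g) (a b : h), ψ x ⁅a, b⁆ = ⁅ψ x a, b⁆ + ⁅a, ψ x b⁆)
    (c1 : ∀ (x y : g) (a : h),
      ψ x (ψ y a) - ψ y (ψ x a) - ψ ⁅x, y⁆ a = ⁅χ x y, a⁆)
    (c2 : ∀ x y z : g,
      ψ x (χ y z) + ψ y (χ z x) + ψ z (χ x y)
        - χ ⁅x, y⁆ z - χ ⁅y, z⁆ x - χ ⁅z, x⁆ y = 0)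
    (c3 : ∀ (x : g) (a : h),
      ψ (T x) (S a) = S (ψ x (S a) + ψ (T x) a) + S ⁅Φ x, a⁆ - ⁅Φ x, S a⁆)
    (c4 : ∀ x y : g,
      χ (T x) (T y) - S (χ x (T y) + χ (T x) y) - Φ (⁅x, T y⁆ + ⁅T x, y⁆)
        + ψ (T x) (Φ y) - ψ (T y) (Φ x) - S (ψ x (Φ y) - ψ y (Φ x))
        + ⁅Φ x, Φ y⁆ = 0)
    (χ' : g →ₗ[k] g →ₗ[k] h) (ψ' : g →ₗ[k] h →ₗ[k] h) (Φ' : g →ₗ[k] h)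
    (hχ'alt : ∀ x : g, χ' x x = 0)
    (hψ'der : ∀ (x : g) (a b : h), ψ' x ⁅a, b⁆ = ⁅ψ' x a, b⁆ + ⁅a, ψ' x b⁆)
    (c1' : ∀ (x y : g) (a : h),
      ψ' x (ψ' y a) - ψ' y (ψ' x a) - ψ' ⁅x, y⁆ a = ⁅χ' x y, a⁆)
    (c2' : ∀ x y z : g,
      ψ' x (χ' y z) + ψ' y (χ' z x) + ψ' z (χ' x y)
        - χ' ⁅x, y⁆ z - χ' ⁅y, z⁆ x - χ' ⁅z, x⁆ y = 0)
    (c3' : ∀ (x : g) (a : h),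
      ψ' (T x) (S a) = S (ψ' x (S a) + ψ' (T x) a) + S ⁅Φ' x, a⁆ - ⁅Φ' x, S a⁆)
    (c4' : ∀ x y : g,
      χ' (T x) (T y) - S (χ' x (T y) + χ' (T x) y) - Φ' (⁅x, T y⁆ + ⁅T x, y⁆)
        + ψ' (T x) (Φ' y) - ψ' (T y) (Φ' x) - S (ψ' x (Φ' y) - ψ' y (Φ' x))
        + ⁅Φ' x, Φ' y⁆ = 0)
    (φ : g →ₗ[k] h)
    (e1 : ∀ (x : g) (a : h), ψ x a - ψ' x a = ⁅φ x, a⁆)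
    (e2 : ∀ x y : g,
      χ x y - χ' x y = ψ' x (φ y) - ψ' y (φ x) - φ ⁅x, y⁆ + ⁅φ x, φ y⁆)
    (e3 : ∀ x : g, Φ x - Φ' x = S (φ x) - φ (T x)) :
    ∀ B : g × h → g × h → g × h,
      (∀ u v : g × h,
        B u v = (⁅u.1, v.1⁆, ψ u.1 v.2 - ψ v.1 u.2 + χ u.1 v.1 + ⁅u.2, v.2⁆)) →
    ∀ B' : g × h → g × h → g × h,
      (∀ u v : g × h,
        B' u v = (⁅u.1, v.1⁆, ψ' u.1 v.2 - ψ' v.1 u.2 + χ' u.1 v.1 + ⁅u.2, v.2⁆)) →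
    ∀ UΦ : g × h → g × h, (∀ u : g × h, UΦ u = (T u.1, S u.2 + Φ u.1)) →
    ∀ UΦ' : g × h → g × h, (∀ u : g × h, UΦ' u = (T u.1, S u.2 + Φ' u.1)) →
    ∀ Θ : g × h → g × h, (∀ u : g × h, Θ u = (u.1, φ u.1 + u.2)) →
      (∀ u v : g × h, Θ (u + v) = Θ u + Θ v) ∧
      (∀ (c : k) (u : g × h), Θ (c • u) = c • Θ u) ∧
      Function.Bijective Θ ∧
      (∀ u v : g × h, Θ (B u v) = B' (Θ u) (Θ v)) ∧
      (∀ u : g × h, UΦ' (Θ u) = Θ (UΦ u)) := by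
  intro B hB B' hB' UΦ hU UΦ' hU' Θ hΘ
  refine ⟨fun u v => ?_, fun c u => ?_, ⟨fun u v huv => ?_, fun v => ?_⟩,
    fun u v => ?_, fun u => ?_⟩
  · simp only [hΘ, Prod.ext_iff, Prod.fst_add, Prod.snd_add, map_add, true_and]
    abel
  · simp only [hΘ, Prod.ext_iff, Prod.smul_fst, Prod.smul_snd, map_smul, smul_add, and_self]
  · simp only [hΘ, Prod.mk.injEq] at huv
    obtain ⟨h₁, h₂⟩ := huv
    rw [h₁] at h₂
    exact Prod.ext h₁ (add_left_cancel h₂)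
  · exact ⟨(v.1, v.2 - φ v.1), by simp [hΘ]⟩
  · simp only [hΘ, hB, hB', Prod.mk.injEq, true_and, map_add, add_lie, lie_add]
    rw [← sub_eq_zero, sub_eq_iff_eq_add.mp (e1 u.1 v.2), sub_eq_iff_eq_add.mp (e1 v.1 u.2),
      sub_eq_iff_eq_add.mp (e2 u.1 v.1), ← lie_skew u.2 (φ v.1)]
    abel
  · simp only [hΘ, hU, hU', Prod.mk.injEq, true_and, map_add]
    rw [sub_eq_iff_eq_add.mp (e3 u.1)]
    abel
end

section
/- Let 0 → h_S →^i e_U →^p g_T → 0 be a non-abelian extension of Rota-Baxter Lie algebras with section s and induced triple (χ, ψ, Φ). Suppose the pair (β, α) ∈ Aut(h_S) × Aut(g_T) is inducible, say via γ ∈ Aut_h(e_U) with γ|_h = β and p∘γ∘s = α. Then the map λ = γ∘s − s∘α takes values in h, and for all x, y ∈ g and h ∈ h: (I) β(ψ_x(h)) − ψ_{α(x)}(β(h)) = [λ(x), β(h)]_h; (II) β(χ(x,y)) − χ(α(x), α(y)) = ψ_{α(x)}(λ(y)) − ψ_{α(y)}(λ(x)) − λ([x,y]_g) + [λ(x), λ(y)]_h;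 (III) β(Φ(x)) − Φ(α(x)) = S(λ(x)) − λ(T(x)). -/
/-- if the pair (β, α) is induced by γ ∈ Aut_h(e_U), then
λ = γ∘s − s∘α takes values in h and satisfies conditions (I), (II), (III). -/
theorem stmt7
    {k g h e : Type*} [Field k] [CharZero k]
    [LieRing g] [LieAlgebra k g] [LieRing h] [LieAlgebra k h]
    [LieRing e] [LieAlgebra k e]
    (T : g →ₗ[k] g) (S : h →ₗ[k] h) (U : e →ₗ[k] e)
    (hT : ∀ x y : g, ⁅T x, T y⁆ = T (⁅T x, y⁆ + ⁅x, T y⁆))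
    (hS : ∀ a b : h, ⁅S a, S b⁆ = S (⁅S a, b⁆ + ⁅a, S b⁆))
    (hU : ∀ u v : e, ⁅U u, U v⁆ = U (⁅U u, v⁆ + ⁅u, U v⁆))
    (i : h →ₗ⁅k⁆ e) (p : e →ₗ⁅k⁆ g)
    (hi : Function.Injective i) (hp : Function.Surjective p)
    (hiU : ∀ a : h, U (i a) = i (S a))
    (hpU : ∀ v : e, p (U v) = T (p v))
    (hexact : ∀ v : e, p v = 0 ↔ ∃ a : h, i a = v)
    (s : g →ₗ[k] e) (hs : ∀ x : g, p (s x) = x)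
    (χ : g → g → h) (ψ : g → h → h) (Φ : g → h)
    (hχ : ∀ x y : g, i (χ x y) = ⁅s x, s y⁆ - s ⁅x, y⁆)
    (hψ : ∀ (x : g) (a : h), i (ψ x a) = ⁅s x, i a⁆)
    (hΦ : ∀ x : g, i (Φ x) = U (s x) - s (T x))
    (β : h →ₗ[k] h) (hβbij : Function.Bijective β)
    (hβlie : ∀ a b : h, β ⁅a, b⁆ = ⁅β a, β b⁆)
    (hβS : ∀ a : h, β (S a) = S (β a))
    (α : g →ₗ[k] g) (hαbij : Function.Bijective α)
    (hαlie : ∀ x y : g, α ⁅x, y⁆ = ⁅α x, α y⁆)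
    (hαT : ∀ x : g, α (T x) = T (α x))
    (γ : e →ₗ[k] e) (hγbij : Function.Bijective γ)
    (hγlie : ∀ u v : e, γ ⁅u, v⁆ = ⁅γ u, γ v⁆)
    (hγU : ∀ v : e, γ (U v) = U (γ v))
    (hγi : ∀ a : h, γ (i a) = i (β a))
    (hγs : ∀ x : g, p (γ (s x)) = α x) :
    ∃ lam : g → h,
      (∀ x : g, i (lam x) = γ (s x) - s (α x)) ∧
      (∀ (x : g) (a : h), β (ψ x a) - ψ (α x) (β a) = ⁅lam x, β a⁆) ∧
      (∀ x y : g, β (χ x y) - χ (α x) (α y)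
        = ψ (α x) (lam y) - ψ (α y) (lam x) - lam ⁅x, y⁆ + ⁅lam x, lam y⁆) ∧
      (∀ x : g, β (Φ x) - Φ (α x) = S (lam x) - lam (T x)) := by
  have hker : ∀ x : g, ∃ a : h, i a = γ (s x) - s (α x) := fun x =>
    (hexact _).1 (by rw [map_sub, hγs, hs, sub_self])
  choose lam hlam using hker
  have hsplit : ∀ x : g, γ (s x) = i (lam x) + s (α x) := fun x => by
    rw [hlam, sub_add_cancel]
  refine ⟨lam, hlam, fun x a => hi ?_, fun x y => hi ?_, fun x => hi ?_⟩
  · rw [map_sub, ← hγi, hψ, hψ, hγlie, hγi, hsplit, LieHom.map_lie, add_lie, add_sub_cancel_right]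
  · simp only [map_sub, map_add, LieHom.map_lie, ← hγi, hχ, hψ, hγlie, hsplit, hαlie,
      add_lie, lie_add]
    rw [← lie_skew (s (α y)) (i (lam x))]
    abel
  · simp only [map_sub, ← hγi, hΦ, hγU, hsplit, hαT, map_add, hiU]
    abel
end

section
/- Let 0 → h_S →^i e_U →^p g_T → 0 be a non-abelian extension of Rota-Baxter Lie algebras with section s and induced triple (χ, ψ, Φ), and let (β, α) ∈ Aut(h_S) × Aut(g_T). Suppose there exists a linear map λ : g → h satisfying, for all x, y ∈ g and h ∈ h: (I) β(ψ_x(h)) − ψ_{α(x)}(β(h)) = [λ(x), β(h)]_h; (II) β(χ(x,y)) − χ(α(x), α(y)) = ψ_{α(x)}(λ(y)) − ψ_{α(y)}(λ(x)) − λ([x,y]_g) + [λ(x), λ(y)]_h; (III) β(Φ(x)) − Φ(α(x)) = S(λ(x)) − λ(T(x)). Then the map γ : e → e defined on e = h ⊕ s(g) by γ(h + s(x)) = (β(h) + λ(x)) + s(α(x)) is a bijective Lie algebra homomorphism satisfying γ∘U = U∘γ, γ|_h = β and p∘γ∘s = α; in particular the pair (β, α) is inducible. -/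
/-- given (β, α) and a linear map λ : g → h satisfying (I), (II),
(III), the map γ(h + s(x)) = (β(h) + λ(x)) + s(α(x)) is a Rota-Baxter Lie
algebra automorphism of e_U inducing the pair (β, α). -/
theorem stmt8
    {k g h e : Type*} [Field k] [CharZero k]
    [LieRing g] [LieAlgebra k g] [LieRing h] [LieAlgebra k h]
    [LieRing e] [LieAlgebra k e]
    (T : g →ₗ[k] g) (S : h →ₗ[k] h) (U : e →ₗ[k] e)
    (hT : ∀ x y : g, ⁅T x, T y⁆ = T (⁅T x, y⁆ + ⁅x, T y⁆))
    (hS : ∀ a b : h, ⁅S a, S b⁆ = S (⁅S a, b⁆ + ⁅a, S b⁆))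
    (hU : ∀ u v : e, ⁅U u, U v⁆ = U (⁅U u, v⁆ + ⁅u, U v⁆))
    (i : h →ₗ⁅k⁆ e) (p : e →ₗ⁅k⁆ g)
    (hi : Function.Injective i) (hp : Function.Surjective p)
    (hiU : ∀ a : h, U (i a) = i (S a))
    (hpU : ∀ v : e, p (U v) = T (p v))
    (hexact : ∀ v : e, p v = 0 ↔ ∃ a : h, i a = v)
    (s : g →ₗ[k] e) (hs : ∀ x : g, p (s x) = x)
    (χ : g → g → h) (ψ : g → h → h) (Φ : g → h)
    (hχ : ∀ x y : g, i (χ x y) = ⁅s x, s y⁆ - s ⁅x, y⁆)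
    (hψ : ∀ (x : g) (a : h), i (ψ x a) = ⁅s x, i a⁆)
    (hΦ : ∀ x : g, i (Φ x) = U (s x) - s (T x))
    (β : h →ₗ[k] h) (hβbij : Function.Bijective β)
    (hβlie : ∀ a b : h, β ⁅a, b⁆ = ⁅β a, β b⁆)
    (hβS : ∀ a : h, β (S a) = S (β a))
    (α : g →ₗ[k] g) (hαbij : Function.Bijective α)
    (hαlie : ∀ x y : g, α ⁅x, y⁆ = ⁅α x, α y⁆)
    (hαT : ∀ x : g, α (T x) = T (α x))
    (lam : g →ₗ[k] h)
    (hI : ∀ (x : g) (a : h), β (ψ x a) - ψ (α x) (β a) = ⁅lam x, β a⁆)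
    (hII : ∀ x y : g, β (χ x y) - χ (α x) (α y)
      = ψ (α x) (lam y) - ψ (α y) (lam x) - lam ⁅x, y⁆ + ⁅lam x, lam y⁆)
    (hIII : ∀ x : g, β (Φ x) - Φ (α x) = S (lam x) - lam (T x)) :
    ∃ γ : e → e,
      (∀ (a : h) (x : g), γ (i a + s x) = (i (β a) + i (lam x)) + s (α x)) ∧
      (∀ u v : e, γ (u + v) = γ u + γ v) ∧
      (∀ (c : k) (v : e), γ (c • v) = c • γ v) ∧
      Function.Bijective γ ∧
      (∀ u v : e, γ ⁅u, v⁆ = ⁅γ u, γ v⁆) ∧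
      (∀ v : e, γ (U v) = U (γ v)) ∧
      (∀ a : h, γ (i a) = i (β a)) ∧
      (∀ x : g, p (γ (s x)) = α x) := by
  have hpi : ∀ a : h, p (i a) = 0 := fun a => (hexact _).2 ⟨a, rfl⟩
  have hdec : ∀ v : e, ∃ a : h, i a = v - s (p v) := fun v =>
    (hexact _).1 (by rw [map_sub, hs, sub_self])
  choose r hr using hdec
  have hri : ∀ (a : h) (x : g), r (i a + s x) = a := fun a x => hi (by
    rw [hr, map_add, hpi, hs, zero_add, add_sub_cancel_right])
  have hrep : ∀ v : e, ∃ (a : h) (x : g), v = i a + s x := fun v =>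
    ⟨r v, p v, by rw [hr, sub_add_cancel]⟩
  have hψadd : ∀ (x : g) (a b : h), ψ x (a + b) = ψ x a + ψ x b := fun x a b => hi (by
    rw [map_add, hψ, hψ, hψ, map_add, lie_add])
  have hbracket : ∀ (a b : h) (x y : g), ⁅i a + s x, i b + s y⁆
      = i (⁅a, b⁆ + ψ x b - ψ y a + χ x y) + s ⁅x, y⁆ := by
    intro a b x y
    rw [map_add, map_sub, map_add, hψ, hψ, hχ, LieHom.map_lie, add_lie, lie_add, lie_add,
      ← lie_skew (i a) (s y)]
    abel
  have hUdec : ∀ (a : h) (x : g), U (i a + s x) = i (S a + Φ x) + s (T x) := by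
    intro a x
    rw [map_add, map_add, hiU, hΦ]
    abel
  obtain ⟨γ, hγ⟩ : ∃ γ : e → e, ∀ (a : h) (x : g),
      γ (i a + s x) = i (β a + lam x) + s (α x) := by
    refine ⟨fun v => i (β (r v) + lam (p v)) + s (α (p v)), fun a x => ?_⟩
    simp only [hri, map_add, hpi, hs, zero_add]
  have hγi : ∀ a : h, γ (i a) = i (β a) := fun a => by simpa using hγ a 0
  have hγs : ∀ x : g, γ (s x) = i (lam x) + s (α x) := fun x => by simpa using hγ 0 x
  refine ⟨γ, fun a x => by rw [hγ, map_add], ?_, ?_, ⟨?_, ?_⟩, ?_, ?_, hγi, ?_⟩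
  · intro u v
    obtain ⟨a, x, rfl⟩ := hrep u
    obtain ⟨b, y, rfl⟩ := hrep v
    have : i a + s x + (i b + s y) = i (a + b) + s (x + y) := by
      rw [map_add, map_add]; abel
    rw [this, hγ, hγ, hγ]
    simp only [map_add]
    abel
  · intro c v
    obtain ⟨a, x, rfl⟩ := hrep v
    have : c • (i a + s x) = i (c • a) + s (c • x) := by
      rw [smul_add, map_smul, map_smul]
    rw [this, hγ, hγ]
    simp only [map_add, map_smul, smul_add]
  · intro u v huv
    obtain ⟨a, x, rfl⟩ := hrep u
    obtain ⟨b, y, rfl⟩ := hrep v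
    rw [hγ, hγ] at huv
    have hx : x = y := hαbij.1 (by simpa [hpi, hs] using congrArg p huv)
    subst hx
    have ha : a = b := hβbij.1 (add_right_cancel (hi (add_right_cancel huv)))
    rw [ha]
  · intro v
    obtain ⟨b, y, rfl⟩ := hrep v
    obtain ⟨x, rfl⟩ := hαbij.2 y
    obtain ⟨a, ha⟩ := hβbij.2 (b - lam x)
    exact ⟨i a + s x, by rw [hγ, ha, sub_add_cancel]⟩
  · intro u v
    obtain ⟨a, x, rfl⟩ := hrep u
    obtain ⟨b, y, rfl⟩ := hrep v
    rw [hbracket, hγ, hγ, hγ, hbracket, hαlie]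
    congr 2
    have hxb := sub_eq_iff_eq_add.1 (hI x b)
    have hya := sub_eq_iff_eq_add.1 (hI y a)
    have hxy := sub_eq_iff_eq_add.1 (hII x y)
    rw [map_add, map_sub, map_add, hβlie, hxb, hya, hxy, hψadd, hψadd, add_lie, lie_add, lie_add,
      ← lie_skew (β a) (lam y)]
    abel
  · intro v
    obtain ⟨a, x, rfl⟩ := hrep v
    have hx := sub_eq_iff_eq_add.1 (hIII x)
    rw [hUdec, hγ, hγ, hUdec, hαT, map_add β, map_add S, hβS, hx]
    congr 2
    abel
  · intro x
    rw [hγs, map_add, hpi, hs, zero_add]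
end

section
/- Let 0 → h_S →^i e_U →^p g_T → 0 be a non-abelian extension of Rota-Baxter Lie algebras with section s and induced non-abelian 2-cocycle (χ, ψ, Φ). For any pair (β, α) ∈ Aut(h_S) × Aut(g_T), the triple (χ_{(β,α)}, ψ_{(β,α)}, Φ_{(β,α)}) defined by χ_{(β,α)}(x,y) = β(χ(α⁻¹(x), α⁻¹(y))), (ψ_{(β,α)})_x(h) = β(ψ_{α⁻¹(x)}(β⁻¹(h))), Φ_{(β,α)}(x) = β(Φ(α⁻¹(x))) is again a non-abelian 2-cocycle of g_T with values in h_S. -/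
/-- The maps induced by a linear section of an extension of Rota-Baxter Lie algebras satisfy the
non-abelian 2-cocycle identities. -/
theorem nonabelian_cocycle_of_section
    {k g h e : Type*} [CommRing k]
    [LieRing g] [LieAlgebra k g] [LieRing h] [LieAlgebra k h]
    [LieRing e] [LieAlgebra k e]
    (T : g →ₗ[k] g) (S : h →ₗ[k] h) (U : e →ₗ[k] e)
    (hT : ∀ x y : g, ⁅T x, T y⁆ = T (⁅T x, y⁆ + ⁅x, T y⁆))
    (hU : ∀ u v : e, ⁅U u, U v⁆ = U (⁅U u, v⁆ + ⁅u, U v⁆))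
    (i : h →ₗ⁅k⁆ e) (hi : Function.Injective i) (hiU : ∀ a : h, U (i a) = i (S a))
    (s : g →ₗ[k] e)
    (χ : g → g → h) (ψ : g → h → h) (Φ : g → h)
    (hχ : ∀ x y : g, i (χ x y) = ⁅s x, s y⁆ - s ⁅x, y⁆)
    (hψ : ∀ (x : g) (a : h), i (ψ x a) = ⁅s x, i a⁆)
    (hΦ : ∀ x : g, i (Φ x) = U (s x) - s (T x)) :
    (∀ (x y : g) (a : h), ψ x (ψ y a) - ψ y (ψ x a) - ψ ⁅x, y⁆ a = ⁅χ x y, a⁆) ∧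
    (∀ x y z : g,
      ψ x (χ y z) + ψ y (χ z x) + ψ z (χ x y)
        - χ ⁅x, y⁆ z - χ ⁅y, z⁆ x - χ ⁅z, x⁆ y = 0) ∧
    (∀ (x : g) (a : h),
      ψ (T x) (S a) = S (ψ x (S a) + ψ (T x) a) + S ⁅Φ x, a⁆ - ⁅Φ x, S a⁆) ∧
    (∀ x y : g,
      χ (T x) (T y) - S (χ x (T y) + χ (T x) y) - Φ (⁅x, T y⁆ + ⁅T x, y⁆)
        + ψ (T x) (Φ y) - ψ (T y) (Φ x) - S (ψ x (Φ y) - ψ y (Φ x))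
        + ⁅Φ x, Φ y⁆ = 0) := by
  refine ⟨fun x y a => hi ?_, fun x y z => hi ?_, fun x a => hi ?_, fun x y => hi ?_⟩
  · simp only [map_sub, LieHom.map_lie, hψ, hχ, sub_lie, leibniz_lie (s x) (s y) (i a)]
    abel
  · have hg : s ⁅⁅x, y⁆, z⁆ + s ⁅⁅y, z⁆, x⁆ + s ⁅⁅z, x⁆, y⁆ = 0 := by
      rw [← map_add, ← map_add, ← lie_skew ⁅x, y⁆ z, ← lie_skew ⁅y, z⁆ x, ← lie_skew ⁅z, x⁆ y,
        ← map_zero s, ← neg_zero, ← lie_jacobi x y z]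
      congr 1
      abel
    have he := lie_jacobi (s x) (s y) (s z)
    simp only [map_sub, map_add, map_zero, hψ, hχ, lie_sub]
    rw [← lie_skew (s ⁅x, y⁆) (s z), ← lie_skew (s ⁅y, z⁆) (s x), ← lie_skew (s ⁅z, x⁆) (s y)]
    linear_combination (norm := abel) he + hg
  · have h1 := hU (s x) (i a)
    have hs : U (s x) = s (T x) + i (Φ x) := by rw [hΦ]; abel
    simp only [hs, hiU, add_lie, map_add, ← hψ, ← LieHom.map_lie] at h1
    simp only [map_sub, map_add]
    rw [eq_sub_iff_add_eq, h1]
    abel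
  · have hs (w : g) : U (s w) = s (T w) + i (Φ w) := by rw [hΦ]; abel
    have hss (v w : g) : ⁅s v, s w⁆ = i (χ v w) + s ⁅v, w⁆ := by rw [hχ]; abel
    have his (v : g) (a : h) : ⁅i a, s v⁆ = -i (ψ v a) := by rw [hψ, lie_skew]
    have h1 := hU (s x) (s y)
    have hΦadd (v w : g) : i (Φ (v + w)) = i (Φ v) + i (Φ w) := by
      simp only [hΦ, map_add]; abel
    simp only [hs, hss, his, hiU, add_lie, lie_add, map_add, map_neg, ← hψ, ← LieHom.map_lie,
      hT] at h1
    simp only [map_sub, map_add, hΦadd, map_zero]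
    rw [← sub_eq_zero] at h1
    rw [← h1]
    abel


/-- the transformed triple (χ_{(β,α)}, ψ_{(β,α)}, Φ_{(β,α)}) of
the 2-cocycle induced by a non-abelian extension is again a non-abelian
2-cocycle. -/
theorem stmt9
    {k g h e : Type*} [Field k] [CharZero k]
    [LieRing g] [LieAlgebra k g] [LieRing h] [LieAlgebra k h]
    [LieRing e] [LieAlgebra k e]
    (T : g →ₗ[k] g) (S : h →ₗ[k] h) (U : e →ₗ[k] e)
    (hT : ∀ x y : g, ⁅T x, T y⁆ = T (⁅T x, y⁆ + ⁅x, T y⁆))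
    (hS : ∀ a b : h, ⁅S a, S b⁆ = S (⁅S a, b⁆ + ⁅a, S b⁆))
    (hU : ∀ u v : e, ⁅U u, U v⁆ = U (⁅U u, v⁆ + ⁅u, U v⁆))
    (i : h →ₗ⁅k⁆ e) (p : e →ₗ⁅k⁆ g)
    (hi : Function.Injective i) (hp : Function.Surjective p)
    (hiU : ∀ a : h, U (i a) = i (S a))
    (hpU : ∀ v : e, p (U v) = T (p v))
    (hexact : ∀ v : e, p v = 0 ↔ ∃ a : h, i a = v)
    (s : g →ₗ[k] e) (hs : ∀ x : g, p (s x) = x)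
    (χ : g → g → h) (ψ : g → h → h) (Φ : g → h)
    (hχ : ∀ x y : g, i (χ x y) = ⁅s x, s y⁆ - s ⁅x, y⁆)
    (hψ : ∀ (x : g) (a : h), i (ψ x a) = ⁅s x, i a⁆)
    (hΦ : ∀ x : g, i (Φ x) = U (s x) - s (T x))
    (β : h ≃ₗ[k] h) (hβlie : ∀ a b : h, β ⁅a, b⁆ = ⁅β a, β b⁆)
    (hβS : ∀ a : h, β (S a) = S (β a))
    (α : g ≃ₗ[k] g) (hαlie : ∀ x y : g, α ⁅x, y⁆ = ⁅α x, α y⁆)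
    (hαT : ∀ x : g, α (T x) = T (α x)) :
    ∀ χa : g → g → h, (∀ x y : g, χa x y = β (χ (α.symm x) (α.symm y))) →
    ∀ ψa : g → h → h, (∀ (x : g) (a : h), ψa x a = β (ψ (α.symm x) (β.symm a))) →
    ∀ Φa : g → h, (∀ x : g, Φa x = β (Φ (α.symm x))) →
      (∀ (x y : g) (a : h),
        ψa x (ψa y a) - ψa y (ψa x a) - ψa ⁅x, y⁆ a = ⁅χa x y, a⁆) ∧
      (∀ x y z : g,
        ψa x (χa y z) + ψa y (χa z x) + ψa z (χa x y)
          - χa ⁅x, y⁆ z - χa ⁅y, z⁆ x - χa ⁅z, x⁆ y = 0) ∧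
      (∀ (x : g) (a : h),
        ψa (T x) (S a) = S (ψa x (S a) + ψa (T x) a) + S ⁅Φa x, a⁆ - ⁅Φa x, S a⁆) ∧
      (∀ x y : g,
        χa (T x) (T y) - S (χa x (T y) + χa (T x) y) - Φa (⁅x, T y⁆ + ⁅T x, y⁆)
          + ψa (T x) (Φa y) - ψa (T y) (Φa x) - S (ψa x (Φa y) - ψa y (Φa x))
          + ⁅Φa x, Φa y⁆ = 0) := by
  intro χa hχa ψa hψa Φa hΦa
  have hβ (a b : h) : β.symm ⁅a, b⁆ = ⁅β.symm a, β.symm b⁆ :=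
    β.injective (by simp [hβlie])
  have hα (x y : g) : α.symm ⁅x, y⁆ = ⁅α.symm x, α.symm y⁆ :=
    α.injective (by simp [hαlie])
  have hβS' (a : h) : β.symm (S a) = S (β.symm a) := β.injective (by simp [hβS])
  have hαT' (x : g) : α.symm (T x) = T (α.symm x) := α.injective (by simp [hαT])
  let j : h →ₗ⁅k⁆ e := i.comp { β.symm.toLinearMap with map_lie' := fun {a b} => hβ a b }
  have hj (a : h) : j a = i (β.symm a) := rfl
  refine nonabelian_cocycle_of_section T S U hT hU j (hi.comp β.symm.injective) ?_
    (s ∘ₗ α.symm.toLinearMap) χa ψa Φa ?_ ?_ ?_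
  · simp [hj, hiU, hβS']
  · simp [hj, hχa, hχ, hα]
  · simp [hj, hψa, hψ]
  · simp [hj, hΦa, hΦ, hαT']
end

section
/- Let 0 → h_S →^i e_U →^p g_T → 0 be a non-abelian extension of Rota-Baxter Lie algebras with section s and induced non-abelian 2-cocycle (χ, ψ, Φ). A pair (β, α) ∈ Aut(h_S) × Aut(g_T) is inducible if and only if the non-abelian 2-cocycles (χ_{(β,α)}, ψ_{(β,α)}, Φ_{(β,α)}) and (χ, ψ, Φ) are equivalent, i.e., there exists a linear map φ : g → h such that for all x, y ∈ g, h ∈ h: (ψ_{(β,α)})_x(h) − ψ_x(h) = [φ(x), h]_h; χ_{(β,α)}(x,y) − χ(x,y) = ψ_x(φ(y)) − ψ_y(φ(x)) − φ([x,y]_g) + [φ(x), φ(y)]_h; and Φ_{(β,α)}(x) − Φ(x) = S(φ(x)) − φ(T(x)). -/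
/-- A linear map whose values lie in the range of an injective linear map factors through it. -/
theorem LinearMap.exists_factor_of_injective {R M N P : Type*} [Ring R]
    [AddCommGroup M] [Module R M] [AddCommGroup N] [Module R N] [AddCommGroup P] [Module R P]
    (i : N →ₗ[R] P) (hi : Function.Injective i) (f : M →ₗ[R] P) (hf : ∀ x, ∃ a, i a = f x) :
    ∃ φ : M →ₗ[R] N, ∀ x, i (φ x) = f x := by
  choose φ hφ using hf
  exact ⟨{ toFun := φ
           map_add' := fun x y => hi (by simp [hφ])
           map_smul' := fun c x => hi (by simp [hφ]) }, hφ⟩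

/-- a pair (β, α) ∈ Aut(h_S) × Aut(g_T) is inducible if and only
if the non-abelian 2-cocycles (χ_{(β,α)}, ψ_{(β,α)}, Φ_{(β,α)}) and (χ, ψ, Φ)
are equivalent. -/
theorem stmt10
    {k g h e : Type*} [Field k] [CharZero k]
    [LieRing g] [LieAlgebra k g] [LieRing h] [LieAlgebra k h]
    [LieRing e] [LieAlgebra k e]
    (T : g →ₗ[k] g) (S : h →ₗ[k] h) (U : e →ₗ[k] e)
    (hT : ∀ x y : g, ⁅T x, T y⁆ = T (⁅T x, y⁆ + ⁅x, T y⁆))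
    (hS : ∀ a b : h, ⁅S a, S b⁆ = S (⁅S a, b⁆ + ⁅a, S b⁆))
    (hU : ∀ u v : e, ⁅U u, U v⁆ = U (⁅U u, v⁆ + ⁅u, U v⁆))
    (i : h →ₗ⁅k⁆ e) (p : e →ₗ⁅k⁆ g)
    (hi : Function.Injective i) (hp : Function.Surjective p)
    (hiU : ∀ a : h, U (i a) = i (S a))
    (hpU : ∀ v : e, p (U v) = T (p v))
    (hexact : ∀ v : e, p v = 0 ↔ ∃ a : h, i a = v)
    (s : g →ₗ[k] e) (hs : ∀ x : g, p (s x) = x)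
    (χ : g → g → h) (ψ : g → h → h) (Φ : g → h)
    (hχ : ∀ x y : g, i (χ x y) = ⁅s x, s y⁆ - s ⁅x, y⁆)
    (hψ : ∀ (x : g) (a : h), i (ψ x a) = ⁅s x, i a⁆)
    (hΦ : ∀ x : g, i (Φ x) = U (s x) - s (T x))
    (β : h ≃ₗ[k] h) (hβlie : ∀ a b : h, β ⁅a, b⁆ = ⁅β a, β b⁆)
    (hβS : ∀ a : h, β (S a) = S (β a))
    (α : g ≃ₗ[k] g) (hαlie : ∀ x y : g, α ⁅x, y⁆ = ⁅α x, α y⁆)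
    (hαT : ∀ x : g, α (T x) = T (α x)) :
    (∃ γ : e →ₗ[k] e, Function.Bijective γ ∧
      (∀ u v : e, γ ⁅u, v⁆ = ⁅γ u, γ v⁆) ∧
      (∀ v : e, γ (U v) = U (γ v)) ∧
      (∀ a : h, γ (i a) = i (β a)) ∧
      (∀ x : g, p (γ (s x)) = α x)) ↔
    (∃ φ : g →ₗ[k] h,
      (∀ (x : g) (a : h),
        β (ψ (α.symm x) (β.symm a)) - ψ x a = ⁅φ x, a⁆) ∧
      (∀ x y : g,
        β (χ (α.symm x) (α.symm y)) - χ x y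
          = ψ x (φ y) - ψ y (φ x) - φ ⁅x, y⁆ + ⁅φ x, φ y⁆) ∧
      (∀ x : g, β (Φ (α.symm x)) - Φ x = S (φ x) - φ (T x))) := by
  have hpi (a : h) : p (i a) = 0 := (hexact _).2 ⟨a, rfl⟩
  obtain ⟨q, hq⟩ : ∃ q : e →ₗ[k] h, ∀ u, i (q u) = u - s (p u) :=
    LinearMap.exists_factor_of_injective (i : h →ₗ[k] e) hi
      (LinearMap.id - s ∘ₗ (p : e →ₗ[k] g)) fun u => (hexact _).1 (by simp [hs])
  have hdecomp (u : e) : u = i (q u) + s (p u) := by rw [hq, sub_add_cancel]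
  have hbr (x y : g) : ⁅s x, s y⁆ = i (χ x y) + s ⁅x, y⁆ := by rw [hχ, sub_add_cancel]
  have hUs (x : g) : U (s x) = i (Φ x) + s (T x) := by rw [hΦ, sub_add_cancel]
  have hψ_skew (x : g) (a : h) : ⁅i a, s x⁆ = -i (ψ x a) := by rw [hψ, lie_skew]
  have hα_symm_lie (x y : g) : α.symm ⁅x, y⁆ = ⁅α.symm x, α.symm y⁆ :=
    α.injective (by simp [hαlie])
  have hα_symm_T (x : g) : α.symm (T x) = T (α.symm x) := α.injective (by simp [hαT])
  constructor
  · rintro ⟨γ, -, hγlie, hγU, hγi, hγs⟩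
    obtain ⟨φ, hφ⟩ : ∃ φ : g →ₗ[k] h, ∀ x, i (φ x) = γ (s (α.symm x)) - s x :=
      LinearMap.exists_factor_of_injective (i : h →ₗ[k] e) hi
        (γ ∘ₗ s ∘ₗ (α.symm : g →ₗ[k] g) - s) fun x => (hexact _).1 (by simp [hγs, hs])
    have hγφ (x : g) : γ (s (α.symm x)) = i (φ x) + s x := by rw [hφ, sub_add_cancel]
    refine ⟨φ, fun x a => hi ?_, fun x y => hi ?_, fun x => hi ?_⟩
    · rw [map_sub, ← hγi, hψ, hγlie, hγφ, hγi, hψ, LieHom.map_lie]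
      simp
    · rw [map_sub, ← hγi, hχ, map_sub, hγlie, ← hα_symm_lie]
      simp only [hγφ, map_sub, map_add, LieHom.map_lie, lie_add, add_lie, hψ_skew, hψ, hχ]
      abel
    · rw [map_sub, ← hγi, hΦ, map_sub, hγU, ← hα_symm_T]
      simp only [hγφ, map_sub, map_add, hiU, hΦ]
      abel
  · rintro ⟨φ, hφψ, hφχ, hφΦ⟩
    let t : g →ₗ[k] e := (i : h →ₗ[k] e) ∘ₗ φ ∘ₗ (α : g →ₗ[k] g) + s ∘ₗ (α : g →ₗ[k] g)
    let γ : e →ₗ[k] e := (i : h →ₗ[k] e) ∘ₗ (β : h →ₗ[k] h) ∘ₗ q + t ∘ₗ (p : e →ₗ[k] g)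
    have ht (x : g) : t x = i (φ (α x)) + s (α x) := rfl
    have hγ (u : e) : γ u = i (β (q u)) + t (p u) := rfl
    have hqi (a : h) : q (i a) = a := hi (by simp [hq, hpi])
    have hqs (x : g) : q (s x) = 0 := hi (by simp [hq, hs])
    have hγi (a : h) : γ (i a) = i (β a) := by simp [hγ, hqi, hpi]
    have hγs (x : g) : γ (s x) = t x := by simp [hγ, hqs, hs]
    have hpt (x : g) : p (t x) = α x := by simp [ht, hpi, hs]
    have hpγ (u : e) : p (γ u) = α (p u) := by simp [hγ, hpi, hpt]
    have hβψ (x : g) (a : h) : i (β (ψ x a)) = ⁅t x, i (β a)⁆ := by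
      have := hφψ (α x) (β a)
      simp only [LinearEquiv.symm_apply_apply] at this
      rw [sub_eq_iff_eq_add.1 this, map_add, LieHom.map_lie, hψ, ht, add_lie]
    have hβχ (x y : g) : i (β (χ x y)) + t ⁅x, y⁆ = ⁅t x, t y⁆ := by
      have := hφχ (α x) (α y)
      simp only [LinearEquiv.symm_apply_apply] at this
      rw [sub_eq_iff_eq_add.1 this]
      simp only [ht, hαlie, map_sub, map_add, LieHom.map_lie, lie_add, add_lie, hψ_skew, hbr,
        ← hψ]
      abel
    have hβΦ (x : g) : i (β (Φ x)) + t (T x) = U (t x) := by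
      have := hφΦ (α x)
      simp only [LinearEquiv.symm_apply_apply] at this
      rw [sub_eq_iff_eq_add.1 this]
      simp only [ht, hαT, map_sub, map_add, hiU, hUs]
      abel
    refine ⟨γ, ⟨?_, ?_⟩, ?_, ?_, hγi, fun x => by rw [hγs, hpt]⟩
    · refine (injective_iff_map_eq_zero γ).2 fun u hu => ?_
      have hpu : p u = 0 := α.injective (by rw [← hpγ, hu, map_zero, map_zero])
      obtain ⟨a, rfl⟩ := (hexact u).1 hpu
      rw [hγi] at hu
      have ha : a = 0 := β.injective (hi (by rw [hu, map_zero, map_zero]))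
      rw [ha, map_zero]
    · intro v
      obtain ⟨b, hb⟩ := (hexact (v - t (α.symm (p v)))).1 (by simp [hpt])
      refine ⟨i (β.symm b) + s (α.symm (p v)), ?_⟩
      rw [map_add, hγi, hγs, LinearEquiv.apply_symm_apply, hb, sub_add_cancel]
    · intro u v
      rw [hdecomp u, hdecomp v]
      generalize q u = a, p u = x, q v = b, p v = y
      have hβψ_skew : ⁅i (β a), t y⁆ = -i (β (ψ y a)) := by rw [hβψ, lie_skew]
      simp only [map_add, hγi, hγs, lie_add, add_lie, hψ_skew, hbr, ← hψ, ← LieHom.map_lie,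
        map_neg, hβlie, ← hβχ, ← hβψ, hβψ_skew]
    · intro v
      rw [hdecomp v]
      simp only [map_add, hiU, hUs, hγi, hγs, hβS, ← hβΦ]
end

section
/- Let 0 → h_S →^i e_U →^p g_T → 0 be a non-abelian extension of Rota-Baxter Lie algebras, let s and s' be two sections of p with induced triples (χ, ψ, Φ) and (χ', ψ', Φ'), and set φ = s − s' (with values in h). Then for any (β, α) ∈ Aut(h_S) × Aut(g_T), the transformed 2-cocycles (χ_{(β,α)}, ψ_{(β,α)}, Φ_{(β,α)}) and (χ'_{(β,α)}, ψ'_{(β,α)}, Φ'_{(β,α)}) are equivalent via the map β∘φ∘α⁻¹ : g → h; that is, for all x, y ∈ g, h ∈ h: (ψ_{(β,α)})_x(h) − (ψ'_{(β,α)})_x(h) = [β(φ(α⁻¹(x))), h]_h; χ_{(β,α)}(x,y) − χ'_{(β,α)}(x,y) = (ψ'_{(β,α)})_x(βφα⁻¹(y)) − (ψ'_{(β,α)})_y(βφα⁻¹(x)) − βφα⁻¹([x,y]_g) + [βφα⁻¹(x), βφα⁻¹(y)]_h; Φ_{(β,α)}(x) − Φ'_{(β,α)}(x) = S(βφα⁻¹(x))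 − βφα⁻¹(T(x)). -/
/-- the transformed 2-cocycles associated with two different
sections are equivalent via β ∘ φ ∘ α⁻¹, where φ = s − s'. -/
theorem stmt11
    {k g h e : Type*} [Field k] [CharZero k]
    [LieRing g] [LieAlgebra k g] [LieRing h] [LieAlgebra k h]
    [LieRing e] [LieAlgebra k e]
    (T : g →ₗ[k] g) (S : h →ₗ[k] h) (U : e →ₗ[k] e)
    (hT : ∀ x y : g, ⁅T x, T y⁆ = T (⁅T x, y⁆ + ⁅x, T y⁆))
    (hS : ∀ a b : h, ⁅S a, S b⁆ = S (⁅S a, b⁆ + ⁅a, S b⁆))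
    (hU : ∀ u v : e, ⁅U u, U v⁆ = U (⁅U u, v⁆ + ⁅u, U v⁆))
    (i : h →ₗ⁅k⁆ e) (p : e →ₗ⁅k⁆ g)
    (hi : Function.Injective i) (hp : Function.Surjective p)
    (hiU : ∀ a : h, U (i a) = i (S a))
    (hpU : ∀ v : e, p (U v) = T (p v))
    (hexact : ∀ v : e, p v = 0 ↔ ∃ a : h, i a = v)
    (s : g →ₗ[k] e) (hs : ∀ x : g, p (s x) = x)
    (χ : g → g → h) (ψ : g → h → h) (Φ : g → h)
    (hχ : ∀ x y : g, i (χ x y) = ⁅s x, s y⁆ - s ⁅x, y⁆)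
    (hψ : ∀ (x : g) (a : h), i (ψ x a) = ⁅s x, i a⁆)
    (hΦ : ∀ x : g, i (Φ x) = U (s x) - s (T x))
    (s' : g →ₗ[k] e) (hs' : ∀ x : g, p (s' x) = x)
    (χ' : g → g → h) (ψ' : g → h → h) (Φ' : g → h)
    (hχ' : ∀ x y : g, i (χ' x y) = ⁅s' x, s' y⁆ - s' ⁅x, y⁆)
    (hψ' : ∀ (x : g) (a : h), i (ψ' x a) = ⁅s' x, i a⁆)
    (hΦ' : ∀ x : g, i (Φ' x) = U (s' x) - s' (T x))
    (φ : g → h) (hφ : ∀ x : g, i (φ x) = s x - s' x)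
    (β : h ≃ₗ[k] h) (hβlie : ∀ a b : h, β ⁅a, b⁆ = ⁅β a, β b⁆)
    (hβS : ∀ a : h, β (S a) = S (β a))
    (α : g ≃ₗ[k] g) (hαlie : ∀ x y : g, α ⁅x, y⁆ = ⁅α x, α y⁆)
    (hαT : ∀ x : g, α (T x) = T (α x)) :
    ∀ χa : g → g → h, (∀ x y : g, χa x y = β (χ (α.symm x) (α.symm y))) →
    ∀ ψa : g → h → h, (∀ (x : g) (a : h), ψa x a = β (ψ (α.symm x) (β.symm a))) →
    ∀ Φa : g → h, (∀ x : g, Φa x = β (Φ (α.symm x))) →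
    ∀ χb : g → g → h, (∀ x y : g, χb x y = β (χ' (α.symm x) (α.symm y))) →
    ∀ ψb : g → h → h, (∀ (x : g) (a : h), ψb x a = β (ψ' (α.symm x) (β.symm a))) →
    ∀ Φb : g → h, (∀ x : g, Φb x = β (Φ' (α.symm x))) →
    ∀ bfa : g → h, (∀ x : g, bfa x = β (φ (α.symm x))) →
      (∀ (x : g) (a : h), ψa x a - ψb x a = ⁅bfa x, a⁆) ∧
      (∀ x y : g,
        χa x y - χb x y
          = ψb x (bfa y) - ψb y (bfa x) - bfa ⁅x, y⁆ + ⁅bfa x, bfa y⁆) ∧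
      (∀ x : g, Φa x - Φb x = S (bfa x) - bfa (T x)) := by
  intro χa hχa ψa hψa Φa hΦa χb hχb ψb hψb Φb hΦb bfa hbfa
  have ψ_sub (x : g) (a : h) : ψ x a - ψ' x a = ⁅φ x, a⁆ := by
    apply hi
    rw [map_sub, hψ, hψ', LieHom.map_lie, hφ, sub_lie]
  have χ_sub (x y : g) :
      χ x y - χ' x y = ψ' x (φ y) - ψ' y (φ x) - φ ⁅x, y⁆ + ⁅φ x, φ y⁆ := by
    apply hi
    simp only [map_sub, map_add, hχ, hχ', hψ', LieHom.map_lie, hφ, sub_lie, lie_sub]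
    rw [← lie_skew (s' y) (s x), ← lie_skew (s' y) (s' x)]
    abel
  have Φ_sub (x : g) : Φ x - Φ' x = S (φ x) - φ (T x) := by
    apply hi
    simp only [map_sub, hΦ, hΦ', ← hiU, hφ]
    abel
  have α_symm_lie (x y : g) : α.symm ⁅x, y⁆ = ⁅α.symm x, α.symm y⁆ := by
    rw [LinearEquiv.symm_apply_eq, hαlie, α.apply_symm_apply, α.apply_symm_apply]
  have α_symm_T (x : g) : α.symm (T x) = T (α.symm x) := by
    rw [LinearEquiv.symm_apply_eq, hαT, α.apply_symm_apply]
  refine ⟨fun x a => ?_, fun x y => ?_, fun x => ?_⟩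
  · rw [hψa, hψb, hbfa, ← map_sub, ψ_sub, hβlie, β.apply_symm_apply]
  · simp only [hχa, hχb, hψb, hbfa, β.symm_apply_apply, α_symm_lie, ← hβlie, ← map_sub,
      ← map_add, χ_sub]
  · rw [hΦa, hΦb, hbfa, hbfa, α_symm_T, ← hβS, ← map_sub, ← map_sub, Φ_sub]
end

section
/- Let 0 → h_S →^i e_U →^p g_T → 0 be a non-abelian extension of Rota-Baxter Lie algebras with section s, and let τ : Aut_h(e_U) → Aut(h_S) × Aut(g_T) be the homomorphism τ(γ) = (γ|_h, p∘γ∘s). Then the kernel of τ is exactly the subgroup Aut_h^{h,g}(e_U) = { γ ∈ Aut_h(e_U) : γ|_h = id_h and p∘γ∘s = id_g }, and a pair (β, α) ∈ Aut(h_S) × Aut(g_T) lies in the image of τ if and only if the non-abelian 2-cocycles (χ_{(β,α)}, ψ_{(β,α)}, Φ_{(β,α)}) and (χ, ψ, Φ) are equivalent. -/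
/-- A linear map whose values lie in the range of an injective linear map factors through it. -/
theorem exists_linearMap_lift {k M N P : Type*} [Field k]
    [AddCommGroup M] [Module k M] [AddCommGroup N] [Module k N] [AddCommGroup P] [Module k P]
    (i : N →ₗ[k] P) (hi : Function.Injective i) (f : M →ₗ[k] P)
    (hf : ∀ m, ∃ a, i a = f m) : ∃ q : M →ₗ[k] N, ∀ m, i (q m) = f m := by
  choose q hq using hf
  exact ⟨{ toFun := q
           map_add' := fun x y => hi (by simp only [map_add, hq])
           map_smul' := fun c x => hi (by simp only [map_smul, hq, RingHom.id_apply]) }, hq⟩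

/-- the kernel of τ : Aut_h(e_U) → Aut(h_S) × Aut(g_T) is exactly
Aut_h^{h,g}(e_U), and (β, α) lies in the image of τ iff the transformed
2-cocycle is equivalent to (χ, ψ, Φ). -/
theorem stmt12
    {k g h e : Type*} [Field k] [CharZero k]
    [LieRing g] [LieAlgebra k g] [LieRing h] [LieAlgebra k h]
    [LieRing e] [LieAlgebra k e]
    (T : g →ₗ[k] g) (S : h →ₗ[k] h) (U : e →ₗ[k] e)
    (hT : ∀ x y : g, ⁅T x, T y⁆ = T (⁅T x, y⁆ + ⁅x, T y⁆))
    (hS : ∀ a b : h, ⁅S a, S b⁆ = S (⁅S a, b⁆ + ⁅a, S b⁆))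
    (hU : ∀ u v : e, ⁅U u, U v⁆ = U (⁅U u, v⁆ + ⁅u, U v⁆))
    (i : h →ₗ⁅k⁆ e) (p : e →ₗ⁅k⁆ g)
    (hi : Function.Injective i) (hp : Function.Surjective p)
    (hiU : ∀ a : h, U (i a) = i (S a))
    (hpU : ∀ v : e, p (U v) = T (p v))
    (hexact : ∀ v : e, p v = 0 ↔ ∃ a : h, i a = v)
    (s : g →ₗ[k] e) (hs : ∀ x : g, p (s x) = x)
    (χ : g → g → h) (ψ : g → h → h) (Φ : g → h)
    (hχ : ∀ x y : g, i (χ x y) = ⁅s x, s y⁆ - s ⁅x, y⁆)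
    (hψ : ∀ (x : g) (a : h), i (ψ x a) = ⁅s x, i a⁆)
    (hΦ : ∀ x : g, i (Φ x) = U (s x) - s (T x))
    (β : h ≃ₗ[k] h) (hβlie : ∀ a b : h, β ⁅a, b⁆ = ⁅β a, β b⁆)
    (hβS : ∀ a : h, β (S a) = S (β a))
    (α : g ≃ₗ[k] g) (hαlie : ∀ x y : g, α ⁅x, y⁆ = ⁅α x, α y⁆)
    (hαT : ∀ x : g, α (T x) = T (α x)) :
    (∀ γ : e →ₗ[k] e, Function.Bijective γ →
      (∀ u v : e, γ ⁅u, v⁆ = ⁅γ u, γ v⁆) →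
      (∀ v : e, γ (U v) = U (γ v)) →
      (∀ a : h, ∃ b : h, γ (i a) = i b) →
      ∀ βr : h → h, (∀ a : h, γ (i a) = i (βr a)) →
      ∀ αr : g → g, (∀ x : g, p (γ (s x)) = αr x) →
      ((βr = id ∧ αr = id) ↔
        ((∀ a : h, γ (i a) = i a) ∧ (∀ x : g, p (γ (s x)) = x)))) ∧
    ((∃ γ : e →ₗ[k] e, Function.Bijective γ ∧
        (∀ u v : e, γ ⁅u, v⁆ = ⁅γ u, γ v⁆) ∧
        (∀ v : e, γ (U v) = U (γ v)) ∧
        (∀ a : h, γ (i a) = i (β a)) ∧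
        (∀ x : g, p (γ (s x)) = α x)) ↔
      (∃ φ : g →ₗ[k] h,
        (∀ (x : g) (a : h),
          β (ψ (α.symm x) (β.symm a)) - ψ x a = ⁅φ x, a⁆) ∧
        (∀ x y : g,
          β (χ (α.symm x) (α.symm y)) - χ x y
            = ψ x (φ y) - ψ y (φ x) - φ ⁅x, y⁆ + ⁅φ x, φ y⁆) ∧
        (∀ x : g, β (Φ (α.symm x)) - Φ x = S (φ x) - φ (T x)))) := by
  have hpi : ∀ a, p (i a) = 0 := fun a => (hexact _).2 ⟨a, rfl⟩
  refine ⟨?_, ?_, ?_⟩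
  · intro γ _ _ _ _ βr hβr αr hαr
    constructor
    · rintro ⟨rfl, rfl⟩
      exact ⟨hβr, hαr⟩
    · rintro ⟨h1, h2⟩
      exact ⟨funext fun a => hi (by rw [← hβr, h1, id]),
        funext fun x => by rw [← hαr, h2, id]⟩
  · rintro ⟨γ, -, hγl, hγU, hγi, hγs⟩
    obtain ⟨φ, hφ⟩ := exists_linearMap_lift (i : h →ₗ[k] e) hi
      (γ ∘ₗ s ∘ₗ (α.symm : g →ₗ[k] g) - s) (fun x => (hexact _).1 (by simp [hγs, hs]))
    have hγs' : ∀ x, γ (s (α.symm x)) = s x + i (φ x) := fun x => by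
      have := hφ x
      simp only [LieHom.coe_toLinearMap, LinearMap.sub_apply, LinearMap.comp_apply,
        LinearEquiv.coe_coe] at this
      rw [this]; abel
    refine ⟨φ, fun x a => hi ?_, fun x y => hi ?_, fun x => hi ?_⟩
    · rw [map_sub, ← hγi, hψ, hψ, hγl, hγs', hγi, β.apply_symm_apply, add_lie, LieHom.map_lie]
      abel
    · have hα : ⁅α.symm x, α.symm y⁆ = α.symm ⁅x, y⁆ :=
        α.injective (by simp [hαlie])
      have hsk : ⁅i (φ x), s y⁆ = -⁅s y, i (φ x)⁆ := (lie_skew _ _).symm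
      simp only [map_sub, map_add, ← hγi, hψ, hχ, hγl, hγs', hα, add_lie, lie_add,
        LieHom.map_lie, hsk]
      abel
    · have hα : T (α.symm x) = α.symm (T x) := α.injective (by simp [hαT])
      simp only [map_sub, ← hγi, hΦ, hγU, hγs', hα, map_add, hiU]
      abel
  · rintro ⟨φ, h1, h2, h3⟩
    obtain ⟨q, hq⟩ := exists_linearMap_lift (i : h →ₗ[k] e) hi
      (LinearMap.id - s ∘ₗ (p : e →ₗ[k] g)) (fun x => (hexact _).1 (by simp [hs]))
    simp only [LieHom.coe_toLinearMap, LinearMap.sub_apply, LinearMap.comp_apply,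
      LinearMap.id_apply] at hq
    have hqi : ∀ a, q (i a) = a := fun a => hi (by simp [hq, hpi])
    have hqs : ∀ x, q (s x) = 0 := fun x => hi (by simp [hq, hs])
    have hdec : ∀ v, ∃ a x, v = i a + s x := fun v => ⟨q v, p v, by rw [hq]; abel⟩
    obtain ⟨γ, hγi, hγs⟩ : ∃ γ : e →ₗ[k] e, (∀ a, γ (i a) = i (β a)) ∧
        ∀ x, γ (s x) = s (α x) + i (φ (α x)) :=
      ⟨(i : h →ₗ[k] e) ∘ₗ (β : h →ₗ[k] h) ∘ₗ q
        + (s + (i : h →ₗ[k] e) ∘ₗ φ) ∘ₗ (α : g →ₗ[k] g) ∘ₗ (p : e →ₗ[k] g),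
        fun a => by simp [hqi, hpi], fun x => by simp [hqs, hs]⟩
    have hψβ : ∀ x a, i (β (ψ x a)) = ⁅s (α x), i (β a)⁆ + ⁅i (φ (α x)), i (β a)⁆ := fun x a => by
      have := h1 (α x) (β a)
      rw [α.symm_apply_apply, β.symm_apply_apply, sub_eq_iff_eq_add] at this
      rw [this, map_add, LieHom.map_lie, hψ, add_comm]
    have hχβ : ∀ x y, i (β (χ x y)) = ⁅s (α x), s (α y)⁆ - s ⁅α x, α y⁆
        + (⁅s (α x), i (φ (α y))⁆ - ⁅s (α y), i (φ (α x))⁆ - i (φ ⁅α x, α y⁆)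
        + ⁅i (φ (α x)), i (φ (α y))⁆) := fun x y => by
      have := h2 (α x) (α y)
      rw [α.symm_apply_apply, α.symm_apply_apply, sub_eq_iff_eq_add] at this
      simp only [this, map_add, map_sub, LieHom.map_lie, hψ, hχ]
      abel
    have hΦβ : ∀ x, i (β (Φ x)) = U (s (α x)) - s (T (α x))
        + (U (i (φ (α x))) - i (φ (T (α x)))) := fun x => by
      have := h3 (α x)
      rw [α.symm_apply_apply, sub_eq_iff_eq_add] at this
      simp only [this, map_add, map_sub, hΦ, hiU]
      abel
    have hii : ∀ a b, γ ⁅i a, i b⁆ = ⁅γ (i a), γ (i b)⁆ := fun a b => by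
      rw [← LieHom.map_lie, hγi, hβlie, LieHom.map_lie, hγi, hγi]
    have hsi : ∀ x b, γ ⁅s x, i b⁆ = ⁅γ (s x), γ (i b)⁆ := fun x b => by
      rw [← hψ, hγi, hψβ, hγs, hγi, add_lie]
    have his : ∀ a y, γ ⁅i a, s y⁆ = ⁅γ (i a), γ (s y)⁆ := fun a y => by
      rw [← lie_skew, map_neg, hsi, lie_skew]
    have hss : ∀ x y, γ ⁅s x, s y⁆ = ⁅γ (s x), γ (s y)⁆ := fun x y => by
      have hsk : ⁅i (φ (α x)), s (α y)⁆ = -⁅s (α y), i (φ (α x))⁆ := (lie_skew _ _).symm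
      rw [← sub_add_cancel ⁅s x, s y⁆ (s ⁅x, y⁆), ← hχ, map_add, hγi, hχβ, hγs, hγs, hγs,
        hαlie, add_lie, lie_add, lie_add, hsk]
      abel
    refine ⟨γ, ⟨?_, ?_⟩, ?_, ?_, hγi, fun x => by simp [hγs, hs, hpi]⟩
    · rw [injective_iff_map_eq_zero]
      intro v hv
      obtain ⟨a, x, rfl⟩ := hdec v
      rw [map_add, hγi, hγs] at hv
      have hx : x = 0 := by simpa [hs, hpi] using congrArg p hv
      subst hx
      have ha : β a = 0 := hi (by simpa using hv)
      have : a = 0 := by simpa using ha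
      simp [this]
    · intro w
      obtain ⟨b, y, rfl⟩ := hdec w
      refine ⟨i (β.symm (b - φ y)) + s (α.symm y), ?_⟩
      rw [map_add, hγi, hγs, β.apply_symm_apply, α.apply_symm_apply, map_sub]
      abel
    · intro u v
      obtain ⟨a, x, rfl⟩ := hdec u
      obtain ⟨b, y, rfl⟩ := hdec v
      simp only [map_add, add_lie, lie_add, hii, hsi, his, hss]
    · intro v
      obtain ⟨a, x, rfl⟩ := hdec v
      rw [map_add, map_add, map_add, map_add, hiU, hγi, hγi, hβS, hiU,
        ← sub_add_cancel (U (s x)) (s (T x)), ← hΦ, map_add, hγi, hγs, hΦβ, hγs, hαT, map_add]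
      abel
end

section
/- Let 0 → h_S →^i e_U →^p g_T → 0 be an abelian extension of a Rota-Baxter Lie algebra g_T by a representation h_S, with section s and induced maps χ(x,y) = [s(x), s(y)]_e − s([x,y]_g) and Φ(x) = U(s(x)) − s(T(x)). Then (χ, Φ) is a 2-cocycle in the Rota-Baxter Lie algebra cochain complex: δ²(χ) = 0, i.e., ψ_x(χ(y,z)) − ψ_y(χ(x,z)) + ψ_z(χ(x,y)) − χ([x,y]_g, z) + χ([x,z]_g, y) − χ([y,z]_g, x) = 0 for all x, y, z ∈ g, and ∂¹(Φ)(x,y) + χ(T(x), T(y)) − S(χ(T(x), y) + χ(x, T(y))) = 0 for all x, y ∈ g, where ∂¹(Φ)(x,y) = ψ_{T(x)}(Φ(y)) − S(ψ_x(Φ(y))) − ψ_{T(y)}(Φ(x)) + S(ψ_y(Φ(x))) − Φ([T(x), y]_g + [x, T(y)]_g). -/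
/-- for an abelian extension of a Rota-Baxter Lie algebra g_T by
a representation h_S, the pair (χ, Φ) induced by a section is a 2-cocycle in
the Rota-Baxter Lie algebra cochain complex. -/
theorem stmt13
    {k g h e : Type*} [Field k] [CharZero k]
    [LieRing g] [LieAlgebra k g] [AddCommGroup h] [Module k h]
    [LieRing e] [LieAlgebra k e]
    (T : g →ₗ[k] g) (S : h →ₗ[k] h) (U : e →ₗ[k] e)
    (hT : ∀ x y : g, ⁅T x, T y⁆ = T (⁅T x, y⁆ + ⁅x, T y⁆))
    (hU : ∀ u v : e, ⁅U u, U v⁆ = U (⁅U u, v⁆ + ⁅u, U v⁆))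
    (ψ : g →ₗ[k] h →ₗ[k] h)
    (hψmod : ∀ (x y : g) (a : h), ψ ⁅x, y⁆ a = ψ x (ψ y a) - ψ y (ψ x a))
    (hrep : ∀ (x : g) (a : h), ψ (T x) (S a) = S (ψ (T x) a + ψ x (S a)))
    (i : h →ₗ[k] e) (p : e →ₗ⁅k⁆ g)
    (hi : Function.Injective i) (hp : Function.Surjective p)
    (habelian : ∀ a b : h, ⁅i a, i b⁆ = 0)
    (hiU : ∀ a : h, U (i a) = i (S a))
    (hpU : ∀ v : e, p (U v) = T (p v))
    (hexact : ∀ v : e, p v = 0 ↔ ∃ a : h, i a = v)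
    (s : g →ₗ[k] e) (hs : ∀ x : g, p (s x) = x)
    (haction : ∀ (x : g) (a : h), ⁅s x, i a⁆ = i (ψ x a))
    (χ : g → g → h) (Φ : g → h)
    (hχ : ∀ x y : g, i (χ x y) = ⁅s x, s y⁆ - s ⁅x, y⁆)
    (hΦ : ∀ x : g, i (Φ x) = U (s x) - s (T x)) :
    (∀ x y z : g,
      ψ x (χ y z) - ψ y (χ x z) + ψ z (χ x y)
        - χ ⁅x, y⁆ z + χ ⁅x, z⁆ y - χ ⁅y, z⁆ x = 0) ∧
    (∀ x y : g,
      (ψ (T x) (Φ y) - S (ψ x (Φ y)) - ψ (T y) (Φ x) + S (ψ y (Φ x))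
        - Φ (⁅T x, y⁆ + ⁅x, T y⁆))
        + χ (T x) (T y) - S (χ (T x) y + χ x (T y)) = 0) := by
  constructor
  · intro x y z
    apply hi
    have jacobi_g : s ⁅⁅x, y⁆, z⁆ = s ⁅x, ⁅y, z⁆⁆ - s ⁅y, ⁅x, z⁆⁆ := by
      rw [lie_lie, map_sub]
    have jacobi_e : ⁅s z, ⁅s x, s y⁆⁆ = ⁅s y, ⁅s x, s z⁆⁆ - ⁅s x, ⁅s y, s z⁆⁆ := by
      rw [← lie_skew, lie_lie, neg_sub]
    have skew_z : ⁅s ⁅x, y⁆, s z⁆ = -⁅s z, s ⁅x, y⁆⁆ := (lie_skew _ _).symm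
    have skew_y : ⁅s ⁅x, z⁆, s y⁆ = -⁅s y, s ⁅x, z⁆⁆ := (lie_skew _ _).symm
    have skew_x : ⁅s ⁅y, z⁆, s x⁆ = -⁅s x, s ⁅y, z⁆⁆ := (lie_skew _ _).symm
    have skew_gy : s ⁅⁅x, z⁆, y⁆ = -s ⁅y, ⁅x, z⁆⁆ := by rw [← lie_skew, map_neg]
    have skew_gx : s ⁅⁅y, z⁆, x⁆ = -s ⁅x, ⁅y, z⁆⁆ := by rw [← lie_skew, map_neg]
    simp only [map_add, map_sub, map_zero, ← haction, hχ, lie_sub]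
    rw [jacobi_g, jacobi_e, skew_z, skew_y, skew_x, skew_gy, skew_gx]
    abel
  · intro x y
    apply hi
    have hUs (a : g) : U (s a) = i (Φ a) + s (T a) := by rw [hΦ]; abel
    have hss (a b : g) : ⁅s a, s b⁆ = i (χ a b) + s ⁅a, b⁆ := by rw [hχ]; abel
    have haction' (a : h) (b : g) : ⁅i a, s b⁆ = -i (ψ b a) := by
      rw [← haction, lie_skew]
    have key := hU (s x) (s y)
    simp only [hUs, add_lie, lie_add, habelian, haction, haction', hss, hT,
      map_add, map_neg, hiU] at key
    have hΦ_add (a b : g) : i (Φ (a + b)) = i (Φ a) + i (Φ b) := by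
      simp only [hΦ, map_add]; abel
    simp only [map_add, map_sub, map_zero, hΦ_add]
    rw [← sub_eq_zero] at key
    rw [← key]
    abel
end

section
/- Let 0 → h_S →^i e_U →^p g_T → 0 be an abelian extension of a Rota-Baxter Lie algebra g_T by a representation h_S, with section s and induced 2-cocycle (χ, Φ). A pair (β, α) ∈ Aut(h_S) × Aut(g_T) is inducible if and only if β(ψ_x(h)) − ψ_{α(x)}(β(h)) = 0 for all x ∈ g, h ∈ h, and there exists a linear map λ : g → h satisfying β(χ(x,y)) − χ(α(x), α(y)) = ψ_{α(x)}(λ(y)) − ψ_{α(y)}(λ(x)) − λ([x,y]_g) and β(Φ(x)) − Φ(α(x)) = S(λ(x)) − λ(T(x)) for all x, y ∈ g. -/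
/-- A linear map whose values lie in the range of an injective linear map factors through it. -/
theorem LinearMap.exists_lift_of_injective {k m n e : Type*} [Ring k] [AddCommGroup m]
    [Module k m] [AddCommGroup n] [Module k n] [AddCommGroup e] [Module k e]
    (i : n →ₗ[k] e) (hi : Function.Injective i) (f : m →ₗ[k] e) (hf : ∀ x, ∃ a, i a = f x) :
    ∃ q : m →ₗ[k] n, ∀ x, i (q x) = f x := by
  choose q hq using hf
  refine ⟨{ toFun := q, map_add' := fun x y => hi ?_, map_smul' := fun c x => hi ?_ }, hq⟩
  · simp only [hq, map_add]
  · simp only [hq, map_smul, RingHom.id_apply]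

/-- inducibility criterion for a pair (β, α) in an abelian
extension of a Rota-Baxter Lie algebra by a representation. -/
theorem stmt14
    {k g h e : Type*} [Field k] [CharZero k]
    [LieRing g] [LieAlgebra k g] [AddCommGroup h] [Module k h]
    [LieRing e] [LieAlgebra k e]
    (T : g →ₗ[k] g) (S : h →ₗ[k] h) (U : e →ₗ[k] e)
    (hT : ∀ x y : g, ⁅T x, T y⁆ = T (⁅T x, y⁆ + ⁅x, T y⁆))
    (hU : ∀ u v : e, ⁅U u, U v⁆ = U (⁅U u, v⁆ + ⁅u, U v⁆))
    (ψ : g →ₗ[k] h →ₗ[k] h)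
    (hψmod : ∀ (x y : g) (a : h), ψ ⁅x, y⁆ a = ψ x (ψ y a) - ψ y (ψ x a))
    (hrep : ∀ (x : g) (a : h), ψ (T x) (S a) = S (ψ (T x) a + ψ x (S a)))
    (i : h →ₗ[k] e) (p : e →ₗ⁅k⁆ g)
    (hi : Function.Injective i) (hp : Function.Surjective p)
    (habelian : ∀ a b : h, ⁅i a, i b⁆ = 0)
    (hiU : ∀ a : h, U (i a) = i (S a))
    (hpU : ∀ v : e, p (U v) = T (p v))
    (hexact : ∀ v : e, p v = 0 ↔ ∃ a : h, i a = v)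
    (s : g →ₗ[k] e) (hs : ∀ x : g, p (s x) = x)
    (haction : ∀ (x : g) (a : h), ⁅s x, i a⁆ = i (ψ x a))
    (χ : g → g → h) (Φ : g → h)
    (hχ : ∀ x y : g, i (χ x y) = ⁅s x, s y⁆ - s ⁅x, y⁆)
    (hΦ : ∀ x : g, i (Φ x) = U (s x) - s (T x))
    (β : h ≃ₗ[k] h) (hβS : ∀ a : h, β (S a) = S (β a))
    (α : g ≃ₗ[k] g) (hαlie : ∀ x y : g, α ⁅x, y⁆ = ⁅α x, α y⁆)
    (hαT : ∀ x : g, α (T x) = T (α x)) :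
    (∃ γ : e →ₗ[k] e, Function.Bijective γ ∧
      (∀ u v : e, γ ⁅u, v⁆ = ⁅γ u, γ v⁆) ∧
      (∀ v : e, γ (U v) = U (γ v)) ∧
      (∀ a : h, γ (i a) = i (β a)) ∧
      (∀ x : g, p (γ (s x)) = α x)) ↔
    ((∀ (x : g) (a : h), β (ψ x a) - ψ (α x) (β a) = 0) ∧
      ∃ lam : g →ₗ[k] h,
        (∀ x y : g, β (χ x y) - χ (α x) (α y)
          = ψ (α x) (lam y) - ψ (α y) (lam x) - lam ⁅x, y⁆) ∧
        (∀ x : g, β (Φ x) - Φ (α x) = S (lam x) - lam (T x))) := by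
  have hpi : ∀ a, p (i a) = 0 := fun a => (hexact _).2 ⟨a, rfl⟩
  have haction' : ∀ (x : g) (a : h), ⁅i a, s x⁆ = -i (ψ x a) := fun x a => by
    rw [← lie_skew, haction]
  have hbracket : ∀ (a b : h) (x y : g), ⁅i a + s x, i b + s y⁆
      = i (ψ x b - ψ y a + χ x y) + s ⁅x, y⁆ := fun a b x y => by
    simp only [add_lie, lie_add, habelian, haction, haction', map_add, map_sub, hχ]
    abel
  have hUsum : ∀ (a : h) (x : g), U (i a + s x) = i (S a + Φ x) + s (T x) := fun a x => by
    simp only [map_add, hiU, hΦ]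
    abel
  constructor
  · rintro ⟨γ, -, hγlie, hγU, hγi, hγs⟩
    obtain ⟨lam, hlam⟩ := LinearMap.exists_lift_of_injective i hi
      (γ ∘ₗ s - s ∘ₗ (α : g →ₗ[k] g)) (fun x => (hexact _).1 (by simp [hγs, hs]))
    have hγ : ∀ x, γ (s x) = i (lam x) + s (α x) := fun x => by simp [hlam]
    refine ⟨fun x a => hi ?_, lam, fun x y => hi ?_, fun x => hi ?_⟩
    · have h1 := hγlie (s x) (i a)
      rw [haction, hγi, hγi, hγ, add_lie, habelian, haction, zero_add] at h1
      rw [map_sub, h1, sub_self, map_zero]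
    · have h1 := hγlie (s x) (s y)
      rw [hγ x, hγ y, hbracket, ← sub_add_cancel ⁅s x, s y⁆ (s ⁅x, y⁆), ← hχ, map_add, hγi, hγ,
        hαlie] at h1
      have h2 : i (β (χ x y)) + i (lam ⁅x, y⁆)
          = i (ψ (α x) (lam y) - ψ (α y) (lam x) + χ (α x) (α y)) :=
        add_right_cancel ((add_assoc _ _ _).trans h1)
      rw [← map_add] at h2
      rw [eq_sub_of_add_eq (hi h2)]
      congr 1
      abel
    · have h1 := hγU (s x)
      rw [hγ x, hUsum, ← sub_add_cancel (U (s x)) (s (T x)), ← hΦ, map_add, hγi, hγ, hαT] at h1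
      have h2 : i (β (Φ x)) + i (lam (T x)) = i (S (lam x) + Φ (α x)) :=
        add_right_cancel ((add_assoc _ _ _).trans h1)
      rw [← map_add] at h2
      rw [eq_sub_of_add_eq (hi h2)]
      congr 1
      abel
  · rintro ⟨hβψ, lam, hlamχ, hlamΦ⟩
    obtain ⟨q, hq⟩ := LinearMap.exists_lift_of_injective i hi
      (LinearMap.id - s ∘ₗ (p : e →ₗ[k] g)) (fun v => (hexact _).1 (by simp [hs]))
    have hqv : ∀ v, i (q v) + s (p v) = v := fun v => by simp [hq]
    have hqi : ∀ a, q (i a) = a := fun a => hi (by simp [hq, hpi])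
    have hqs : ∀ x, q (s x) = 0 := fun x => hi (by simp [hq, hs])
    obtain ⟨γ, hγ⟩ : ∃ γ : e →ₗ[k] e, ∀ a x, γ (i a + s x) = i (β a + lam x) + s (α x) :=
      ⟨i ∘ₗ ((β : h →ₗ[k] h) ∘ₗ q + lam ∘ₗ (p : e →ₗ[k] g))
        + s ∘ₗ (α : g →ₗ[k] g) ∘ₗ (p : e →ₗ[k] g), fun a x => by simp [hqi, hqs, hpi, hs]⟩
    refine ⟨γ, ⟨?_, fun w => ?_⟩, fun u v => ?_, fun v => ?_, fun a => ?_, fun x => ?_⟩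
    · refine (injective_iff_map_eq_zero γ).2 fun v hv => ?_
      rw [← hqv v, hγ] at hv
      have hpv : p v = 0 := by
        have h1 := congrArg p hv
        simpa [hpi, hs] using h1
      rw [hpv] at hv
      have hqv0 : q v = 0 := by
        have h1 : i (β (q v)) = i 0 := by simpa using hv
        simpa using hi h1
      rw [← hqv v, hpv, hqv0, map_zero, map_zero, add_zero]
    · refine ⟨i (β.symm (q w - lam (α.symm (p w)))) + s (α.symm (p w)), ?_⟩
      rw [hγ, β.apply_symm_apply, α.apply_symm_apply, sub_add_cancel, hqv]
    · rw [← hqv u, ← hqv v, hbracket, hγ, hγ, hγ, hbracket, hαlie]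
      congr 2
      simp only [map_add, map_sub, sub_eq_zero.1 (hβψ _ _), sub_eq_iff_eq_add.1 (hlamχ _ _)]
      abel
    · rw [← hqv v, hUsum, hγ, hγ, hUsum, hαT]
      congr 2
      simp only [map_add, hβS, sub_eq_iff_eq_add.1 (hlamΦ _)]
      abel
    · simpa using hγ a 0
    · simpa [hpi, hs] using congrArg p (hγ 0 x)
end

section
/- Let 0 → h_S →^i e_U →^p g_T → 0 be an abelian extension of a Rota-Baxter Lie algebra g_T by a representation h_S, with section s and induced 2-cocycle (χ, Φ). Let (β, α) ∈ C_ψ be a compatible pair, and define χ_{(β,α)}(x,y) = β(χ(α⁻¹(x), α⁻¹(y))) and Φ_{(β,α)}(x) = β(Φ(α⁻¹(x))). Then (χ_{(β,α)}, Φ_{(β,α)}) is again a 2-cocycle in the Rota-Baxter Lie algebra cochain complex: δ²(χ_{(β,α)}) = 0 and ∂¹(Φ_{(β,α)})(x,y) + χ_{(β,α)}(T(x), T(y)) − S(χ_{(β,α)}(T(x), y)) − S(χ_{(β,α)}(x, T(y))) = 0 for all x, y ∈ g. -/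
/-- The failure of a linear section of an abelian extension to be a Lie algebra homomorphism is a
Chevalley-Eilenberg 2-cocycle. -/
theorem section_bracket_defect_cocycle
    {k g h e : Type*} [Field k]
    [LieRing g] [LieAlgebra k g] [AddCommGroup h] [Module k h]
    [LieRing e] [LieAlgebra k e]
    (ψ : g →ₗ[k] h →ₗ[k] h) (i : h →ₗ[k] e) (hi : Function.Injective i)
    (s : g →ₗ[k] e) (haction : ∀ (x : g) (a : h), ⁅s x, i a⁆ = i (ψ x a))
    (χ : g → g → h) (hχ : ∀ x y : g, i (χ x y) = ⁅s x, s y⁆ - s ⁅x, y⁆)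
    (x y z : g) :
    ψ x (χ y z) - ψ y (χ x z) + ψ z (χ x y)
      - χ ⁅x, y⁆ z + χ ⁅x, z⁆ y - χ ⁅y, z⁆ x = 0 := by
  apply hi
  have jacobi_e := lie_jacobi (s x) (s y) (s z)
  have jacobi_g := congrArg s (lie_jacobi x y z)
  simp only [map_add, map_zero] at jacobi_g
  simp only [map_add, map_sub, map_zero, ← haction, hχ, lie_sub]
  rw [← lie_skew (s z) (s x), lie_neg] at jacobi_e
  rw [← lie_skew z x, lie_neg, map_neg] at jacobi_g
  rw [← lie_skew (s ⁅x, y⁆) (s z), ← lie_skew (s ⁅x, z⁆) (s y), ← lie_skew (s ⁅y, z⁆) (s x),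
    ← lie_skew ⁅x, y⁆ z, ← lie_skew ⁅x, z⁆ y, ← lie_skew ⁅y, z⁆ x, map_neg, map_neg, map_neg]
  grind

/-- The compatibility between the bracket defect and the Rota-Baxter defect of a linear section of
an abelian extension of Rota-Baxter Lie algebras. -/
theorem section_rotaBaxter_defect_cocycle
    {k g h e : Type*} [Field k]
    [LieRing g] [LieAlgebra k g] [AddCommGroup h] [Module k h]
    [LieRing e] [LieAlgebra k e]
    (T : g →ₗ[k] g) (S : h →ₗ[k] h) (U : e →ₗ[k] e)
    (hT : ∀ x y : g, ⁅T x, T y⁆ = T (⁅T x, y⁆ + ⁅x, T y⁆))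
    (hU : ∀ u v : e, ⁅U u, U v⁆ = U (⁅U u, v⁆ + ⁅u, U v⁆))
    (ψ : g →ₗ[k] h →ₗ[k] h) (i : h →ₗ[k] e) (hi : Function.Injective i)
    (habelian : ∀ a b : h, ⁅i a, i b⁆ = 0) (hiU : ∀ a : h, U (i a) = i (S a))
    (s : g →ₗ[k] e) (haction : ∀ (x : g) (a : h), ⁅s x, i a⁆ = i (ψ x a))
    (χ : g → g → h) (Φ : g → h)
    (hχ : ∀ x y : g, i (χ x y) = ⁅s x, s y⁆ - s ⁅x, y⁆)
    (hΦ : ∀ x : g, i (Φ x) = U (s x) - s (T x)) (x y : g) :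
    (ψ (T x) (Φ y) - S (ψ x (Φ y)) - ψ (T y) (Φ x) + S (ψ y (Φ x))
      - Φ (⁅T x, y⁆ + ⁅x, T y⁆))
      + χ (T x) (T y) - S (χ (T x) y) - S (χ x (T y)) = 0 := by
  apply hi
  have hUs (w : g) : U (s w) = s (T w) + i (Φ w) := by rw [hΦ]; abel
  have hss (u v : g) : ⁅s u, s v⁆ = s ⁅u, v⁆ + i (χ u v) := by rw [hχ]; abel
  have haction' (w : g) (a : h) : ⁅i a, s w⁆ = -i (ψ w a) := by rw [← lie_skew, haction]
  have hbaxter := hU (s x) (s y)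
  have hw := hUs (⁅T x, y⁆ + ⁅x, T y⁆)
  rw [← hT, map_add s, map_add U] at hw
  simp only [hUs x, hUs y, add_lie, lie_add, hss, haction, haction', habelian, map_add, map_neg,
    hiU] at hbaxter
  simp only [map_add, map_sub, map_zero]
  grind

/-- for a compatible pair (β, α) ∈ C_ψ, the transformed pair
(χ_{(β,α)}, Φ_{(β,α)}) is again a 2-cocycle in the Rota-Baxter Lie algebra
cochain complex. -/
theorem stmt15
    {k g h e : Type*} [Field k] [CharZero k]
    [LieRing g] [LieAlgebra k g] [AddCommGroup h] [Module k h]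
    [LieRing e] [LieAlgebra k e]
    (T : g →ₗ[k] g) (S : h →ₗ[k] h) (U : e →ₗ[k] e)
    (hT : ∀ x y : g, ⁅T x, T y⁆ = T (⁅T x, y⁆ + ⁅x, T y⁆))
    (hU : ∀ u v : e, ⁅U u, U v⁆ = U (⁅U u, v⁆ + ⁅u, U v⁆))
    (ψ : g →ₗ[k] h →ₗ[k] h)
    (hψmod : ∀ (x y : g) (a : h), ψ ⁅x, y⁆ a = ψ x (ψ y a) - ψ y (ψ x a))
    (hrep : ∀ (x : g) (a : h), ψ (T x) (S a) = S (ψ (T x) a + ψ x (S a)))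
    (i : h →ₗ[k] e) (p : e →ₗ⁅k⁆ g)
    (hi : Function.Injective i) (hp : Function.Surjective p)
    (habelian : ∀ a b : h, ⁅i a, i b⁆ = 0)
    (hiU : ∀ a : h, U (i a) = i (S a))
    (hpU : ∀ v : e, p (U v) = T (p v))
    (hexact : ∀ v : e, p v = 0 ↔ ∃ a : h, i a = v)
    (s : g →ₗ[k] e) (hs : ∀ x : g, p (s x) = x)
    (haction : ∀ (x : g) (a : h), ⁅s x, i a⁆ = i (ψ x a))
    (χ : g → g → h) (Φ : g → h)
    (hχ : ∀ x y : g, i (χ x y) = ⁅s x, s y⁆ - s ⁅x, y⁆)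
    (hΦ : ∀ x : g, i (Φ x) = U (s x) - s (T x))
    (β : h ≃ₗ[k] h) (hβS : ∀ a : h, β (S a) = S (β a))
    (α : g ≃ₗ[k] g) (hαlie : ∀ x y : g, α ⁅x, y⁆ = ⁅α x, α y⁆)
    (hαT : ∀ x : g, α (T x) = T (α x))
    (hcomp : ∀ (x : g) (a : h), β (ψ x a) = ψ (α x) (β a)) :
    ∀ χa : g → g → h, (∀ x y : g, χa x y = β (χ (α.symm x) (α.symm y))) →
    ∀ Φa : g → h, (∀ x : g, Φa x = β (Φ (α.symm x))) →
      (∀ x y z : g,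
        ψ x (χa y z) - ψ y (χa x z) + ψ z (χa x y)
          - χa ⁅x, y⁆ z + χa ⁅x, z⁆ y - χa ⁅y, z⁆ x = 0) ∧
      (∀ x y : g,
        (ψ (T x) (Φa y) - S (ψ x (Φa y)) - ψ (T y) (Φa x) + S (ψ y (Φa x))
          - Φa (⁅T x, y⁆ + ⁅x, T y⁆))
          + χa (T x) (T y) - S (χa (T x) y) - S (χa x (T y)) = 0) := by
  intro χa hχa Φa hΦa
  have hαsymm_lie (x y : g) : α.symm ⁅x, y⁆ = ⁅α.symm x, α.symm y⁆ := by
    rw [LinearEquiv.symm_apply_eq, hαlie]; simp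
  have hαsymm_T (x : g) : α.symm (T x) = T (α.symm x) := by
    rw [LinearEquiv.symm_apply_eq, hαT]; simp
  have hψβ (x : g) (a : h) : ψ x (β a) = β (ψ (α.symm x) a) := by
    rw [hcomp]; simp
  refine ⟨fun x y z => ?_, fun x y => ?_⟩
  · simp only [hχa, hψβ, hαsymm_lie, ← map_sub, ← map_add]
    rw [section_bracket_defect_cocycle ψ i hi s haction χ hχ, map_zero]
  · simp only [hχa, hΦa, hψβ, map_add α.symm, hαsymm_lie, hαsymm_T, ← hβS]
    simp only [← map_sub β, ← map_add β]
    rw [section_rotaBaxter_defect_cocycle T S U hT hU ψ i hi habelian hiU s haction χ Φ hχ hΦ,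
      map_zero]
end

section
/- Let 0 → h_S →^i e_U →^p g_T → 0 be an abelian extension of a Rota-Baxter Lie algebra g_T by a representation h_S, with section s. Then the map γ ↦ γ̄ := γ∘s − s defines a group isomorphism from Aut_h^{h,g}(e_U) (with composition) onto the additive group Der(g_T, h_S) of derivations: for each γ ∈ Aut_h^{h,g}(e_U), the map γ̄ takes values in h and satisfies γ̄([x,y]_g) = ψ_x(γ̄(y)) − ψ_y(γ̄(x)) and S∘γ̄ = γ̄∘T; the assignment satisfies (γ∘η)‾ = γ̄ + η̄; and it is bijective. In particular, the group Aut_h^{h,g}(e_U) is abelian. -/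
/-- An automorphism of the Rota-Baxter Lie algebra e_U that induces the
identity on both h and g (with respect to the section s). -/
def IsAutHG {k e g h : Type*} [Field k]
    [LieRing e] [LieAlgebra k e] [LieRing g] [LieAlgebra k g]
    [AddCommGroup h] [Module k h]
    (U : e →ₗ[k] e) (i : h →ₗ[k] e) (p : e →ₗ⁅k⁆ g) (s : g →ₗ[k] e)
    (γ : e →ₗ[k] e) : Prop :=
  Function.Bijective γ ∧ (∀ u v : e, γ ⁅u, v⁆ = ⁅γ u, γ v⁆) ∧
    (∀ v : e, γ (U v) = U (γ v)) ∧ (∀ a : h, γ (i a) = i a) ∧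
    (∀ x : g, p (γ (s x)) = x)

namespace IsAutHG

variable {k e g h : Type*} [Field k] [LieRing e] [LieAlgebra k e] [LieRing g] [LieAlgebra k g]
  [AddCommGroup h] [Module k h] {U : e →ₗ[k] e} {i : h →ₗ[k] e} {p : e →ₗ⁅k⁆ g} {s : g →ₗ[k] e}

/-- An element of the middle term brackets with the kernel through its image in the quotient. -/
theorem lie_kernel {ψ : g →ₗ[k] h →ₗ[k] h}
    (habelian : ∀ a b : h, ⁅i a, i b⁆ = 0)
    (hexact : ∀ v : e, p v = 0 ↔ ∃ a : h, i a = v)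
    (hs : ∀ x : g, p (s x) = x)
    (haction : ∀ (x : g) (a : h), ⁅s x, i a⁆ = i (ψ x a)) (v : e) (a : h) :
    ⁅v, i a⁆ = i (ψ (p v) a) := by
  obtain ⟨b, hb⟩ := (hexact (v - s (p v))).1 (by rw [map_sub, hs, sub_self])
  rw [← haction, eq_add_of_sub_eq hb.symm, add_lie, habelian, zero_add, map_add,
    (hexact (i b)).2 ⟨b, rfl⟩, hs, zero_add]

theorem kernel_lie {ψ : g →ₗ[k] h →ₗ[k] h}
    (habelian : ∀ a b : h, ⁅i a, i b⁆ = 0)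
    (hexact : ∀ v : e, p v = 0 ↔ ∃ a : h, i a = v)
    (hs : ∀ x : g, p (s x) = x)
    (haction : ∀ (x : g) (a : h), ⁅s x, i a⁆ = i (ψ x a)) (v : e) (a : h) :
    ⁅i a, v⁆ = -i (ψ (p v) a) := by
  rw [← lie_skew, lie_kernel habelian hexact hs haction]

/-- The displacement of a section by an automorphism takes values in the kernel. -/
theorem exists_displacement (hexact : ∀ v : e, p v = 0 ↔ ∃ a : h, i a = v)
    (hs : ∀ x : g, p (s x) = x) {γ : e →ₗ[k] e} (hγ : IsAutHG U i p s γ) :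
    ∃ d : g → h, ∀ x : g, i (d x) = γ (s x) - s x := by
  choose d hd using fun x => (hexact (γ (s x) - s x)).1 (by
    rw [map_sub, hs, hγ.2.2.2.2, sub_self])
  exact ⟨d, hd⟩

/-- An automorphism is determined by its displacement of the section. -/
theorem apply_eq (hexact : ∀ v : e, p v = 0 ↔ ∃ a : h, i a = v)
    (hs : ∀ x : g, p (s x) = x) {γ : e →ₗ[k] e} (hγ : IsAutHG U i p s γ)
    (v : e) : γ v = v + (γ (s (p v)) - s (p v)) := by
  obtain ⟨b, hb⟩ := (hexact (v - s (p v))).1 (by rw [map_sub, hs, sub_self])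
  have hfix := hγ.2.2.2.1 b
  rw [hb, map_sub, sub_eq_sub_iff_add_eq_add] at hfix
  rw [← add_sub_assoc, ← hfix, add_sub_cancel_right]

/-- Composition adds displacements. -/
theorem comp_apply (hexact : ∀ v : e, p v = 0 ↔ ∃ a : h, i a = v)
    (hs : ∀ x : g, p (s x) = x) {γ η : e →ₗ[k] e}
    (hγ : IsAutHG U i p s γ) (hη : IsAutHG U i p s η) (v : e) :
    γ (η v) = v + ((γ (s (p v)) - s (p v)) + (η (s (p v)) - s (p v))) := by
  obtain ⟨d, hd⟩ := hη.exists_displacement hexact hs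
  rw [hη.apply_eq hexact hs v, ← hd, map_add, hγ.2.2.2.1, hγ.apply_eq hexact hs v, add_assoc]

/-- A derivation `d` compatible with the operators yields the automorphism `v ↦ v + i (d (p v))`. -/
theorem of_derivation {T : g →ₗ[k] g} {S : h →ₗ[k] h} {ψ : g →ₗ[k] h →ₗ[k] h}
    (habelian : ∀ a b : h, ⁅i a, i b⁆ = 0)
    (hiU : ∀ a : h, U (i a) = i (S a))
    (hpU : ∀ v : e, p (U v) = T (p v))
    (hexact : ∀ v : e, p v = 0 ↔ ∃ a : h, i a = v)
    (hs : ∀ x : g, p (s x) = x)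
    (haction : ∀ (x : g) (a : h), ⁅s x, i a⁆ = i (ψ x a))
    {d : g →ₗ[k] h} (hd : ∀ x y : g, d ⁅x, y⁆ = ψ x (d y) - ψ y (d x))
    (hdT : ∀ x : g, S (d x) = d (T x)) :
    IsAutHG U i p s (LinearMap.id + i ∘ₗ d ∘ₗ (p : e →ₗ[k] g)) := by
  have hpi (a : h) : p (i a) = 0 := (hexact (i a)).2 ⟨a, rfl⟩
  refine ⟨Function.bijective_iff_has_inverse.2 ⟨fun v => v - i (d (p v)), fun v => ?_, fun v => ?_⟩,
    fun u v => ?_, fun v => ?_, fun a => ?_, fun x => ?_⟩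
  · simp [hpi]
  · simp [hpi]
  · simp only [LinearMap.add_apply, LinearMap.id_apply, LinearMap.comp_apply, LieHom.coe_toLinearMap,
      LieHom.map_lie, hd, add_lie, lie_add, map_add, map_sub, hpi, add_zero,
      lie_kernel habelian hexact hs haction, kernel_lie habelian hexact hs haction]
    abel
  · simp [hiU, hpU, hdT]
  · simp [hpi]
  · simp [hpi, hs]

end IsAutHG

/-- for an abelian extension, γ ↦ γ̄ = γ∘s − s is a group
isomorphism from Aut_h^{h,g}(e_U) onto the additive group Der(g_T, h_S); in
particular Aut_h^{h,g}(e_U) is abelian. -/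
theorem stmt17
    {k g h e : Type*} [Field k] [CharZero k]
    [LieRing g] [LieAlgebra k g] [AddCommGroup h] [Module k h]
    [LieRing e] [LieAlgebra k e]
    (T : g →ₗ[k] g) (S : h →ₗ[k] h) (U : e →ₗ[k] e)
    (hT : ∀ x y : g, ⁅T x, T y⁆ = T (⁅T x, y⁆ + ⁅x, T y⁆))
    (hU : ∀ u v : e, ⁅U u, U v⁆ = U (⁅U u, v⁆ + ⁅u, U v⁆))
    (ψ : g →ₗ[k] h →ₗ[k] h)
    (hψmod : ∀ (x y : g) (a : h), ψ ⁅x, y⁆ a = ψ x (ψ y a) - ψ y (ψ x a))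
    (hrep : ∀ (x : g) (a : h), ψ (T x) (S a) = S (ψ (T x) a + ψ x (S a)))
    (i : h →ₗ[k] e) (p : e →ₗ⁅k⁆ g)
    (hi : Function.Injective i) (hp : Function.Surjective p)
    (habelian : ∀ a b : h, ⁅i a, i b⁆ = 0)
    (hiU : ∀ a : h, U (i a) = i (S a))
    (hpU : ∀ v : e, p (U v) = T (p v))
    (hexact : ∀ v : e, p v = 0 ↔ ∃ a : h, i a = v)
    (s : g →ₗ[k] e) (hs : ∀ x : g, p (s x) = x)
    (haction : ∀ (x : g) (a : h), ⁅s x, i a⁆ = i (ψ x a)) :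
    (∀ γ : e →ₗ[k] e, IsAutHG U i p s γ →
      ∃ d : g → h, (∀ x : g, i (d x) = γ (s x) - s x) ∧
        (∀ x y : g, d ⁅x, y⁆ = ψ x (d y) - ψ y (d x)) ∧
        (∀ x : g, S (d x) = d (T x))) ∧
    (∀ γ η : e →ₗ[k] e, IsAutHG U i p s γ → IsAutHG U i p s η →
      ∀ dγ dη : g → h,
        (∀ x : g, i (dγ x) = γ (s x) - s x) →
        (∀ x : g, i (dη x) = η (s x) - s x) →
        ∀ x : g, γ (η (s x)) - s x = i (dγ x + dη x)) ∧
    (∀ γ γ' : e →ₗ[k] e, IsAutHG U i p s γ → IsAutHG U i p s γ' →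
      (∀ x : g, γ (s x) - s x = γ' (s x) - s x) → γ = γ') ∧
    (∀ d : g →ₗ[k] h,
      (∀ x y : g, d ⁅x, y⁆ = ψ x (d y) - ψ y (d x)) →
      (∀ x : g, S (d x) = d (T x)) →
      ∃ γ : e →ₗ[k] e, IsAutHG U i p s γ ∧ ∀ x : g, γ (s x) - s x = i (d x)) ∧
    (∀ γ η : e →ₗ[k] e, IsAutHG U i p s γ → IsAutHG U i p s η →
      ∀ v : e, γ (η v) = η (γ v)) := by
  refine ⟨fun γ hγ => ?_, fun γ η hγ hη dγ dη hdγ hdη x => ?_, fun γ γ' hγ hγ' heq => ?_,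
    fun d hd hdT => ?_, fun γ η hγ hη v => ?_⟩
  · obtain ⟨d, hd⟩ := hγ.exists_displacement hexact hs
    have hdisp (v : e) : γ v = v + i (d (p v)) := by rw [hγ.apply_eq hexact hs v, hd]
    refine ⟨d, hd, fun x y => hi ?_, fun x => hi ?_⟩
    · have hlie := hγ.2.1 (s x) (s y)
      simp only [hdisp, LieHom.map_lie, hs, add_lie, lie_add, habelian, haction,
        IsAutHG.kernel_lie habelian hexact hs haction] at hlie
      rw [map_sub, ← add_left_cancel_iff (a := ⁅s x, s y⁆), hlie]
      abel
    · have hcomm := hγ.2.2.1 (s x)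
      rw [hdisp, hdisp, hpU, hs, map_add, hiU] at hcomm
      exact (add_left_cancel hcomm).symm
  · rw [hγ.comp_apply hexact hs hη, hs, map_add, hdγ, hdη, add_sub_cancel_left]
  · ext v
    rw [hγ.apply_eq hexact hs, heq, ← hγ'.apply_eq hexact hs]
  · exact ⟨_, IsAutHG.of_derivation habelian hiU hpU hexact hs haction hd hdT, by simp [hs]⟩
  · rw [hγ.comp_apply hexact hs hη, hη.comp_apply hexact hs hγ, add_comm (γ _ - _)]
end

section
/- Let 0 → h_S →^i e_U →^p g_T → 0 be an abelian extension of a Rota-Baxter Lie algebra g_T by a representation h_S, with section s, and let d ∈ Der(g_T, h_S). Then the map d̲ : e → e defined on e = h ⊕ s(g) by d̲(h + s(x)) = (h + d(x)) + s(x) is a bijective Lie algebra homomorphism satisfying U∘d̲ = d̲∘U, it restricts to the identity on h, and p∘d̲∘s = id_g; hence d̲ ∈ Aut_h^{h,g}(e_U). -/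
/-- for an abelian extension and d ∈ Der(g_T, h_S), the map
d̲(h + s(x)) = (h + d(x)) + s(x) is a Rota-Baxter Lie algebra automorphism of
e_U inducing the identity on h and on g. -/
theorem stmt18
    {k g h e : Type*} [Field k] [CharZero k]
    [LieRing g] [LieAlgebra k g] [AddCommGroup h] [Module k h]
    [LieRing e] [LieAlgebra k e]
    (T : g →ₗ[k] g) (S : h →ₗ[k] h) (U : e →ₗ[k] e)
    (hT : ∀ x y : g, ⁅T x, T y⁆ = T (⁅T x, y⁆ + ⁅x, T y⁆))
    (hU : ∀ u v : e, ⁅U u, U v⁆ = U (⁅U u, v⁆ + ⁅u, U v⁆))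
    (ψ : g →ₗ[k] h →ₗ[k] h)
    (hψmod : ∀ (x y : g) (a : h), ψ ⁅x, y⁆ a = ψ x (ψ y a) - ψ y (ψ x a))
    (hrep : ∀ (x : g) (a : h), ψ (T x) (S a) = S (ψ (T x) a + ψ x (S a)))
    (i : h →ₗ[k] e) (p : e →ₗ⁅k⁆ g)
    (hi : Function.Injective i) (hp : Function.Surjective p)
    (habelian : ∀ a b : h, ⁅i a, i b⁆ = 0)
    (hiU : ∀ a : h, U (i a) = i (S a))
    (hpU : ∀ v : e, p (U v) = T (p v))
    (hexact : ∀ v : e, p v = 0 ↔ ∃ a : h, i a = v)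
    (s : g →ₗ[k] e) (hs : ∀ x : g, p (s x) = x)
    (haction : ∀ (x : g) (a : h), ⁅s x, i a⁆ = i (ψ x a))
    (d : g →ₗ[k] h)
    (hd1 : ∀ x y : g, d ⁅x, y⁆ = ψ x (d y) - ψ y (d x))
    (hd2 : ∀ x : g, S (d x) = d (T x)) :
    ∃ γ : e → e,
      (∀ (a : h) (x : g), γ (i a + s x) = (i a + i (d x)) + s x) ∧
      (∀ u v : e, γ (u + v) = γ u + γ v) ∧
      (∀ (c : k) (v : e), γ (c • v) = c • γ v) ∧
      Function.Bijective γ ∧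
      (∀ u v : e, γ ⁅u, v⁆ = ⁅γ u, γ v⁆) ∧
      (∀ v : e, U (γ v) = γ (U v)) ∧
      (∀ a : h, γ (i a) = i a) ∧
      (∀ x : g, p (γ (s x)) = x) := by
  have hpi : ∀ a : h, p (i a) = 0 := fun a => (hexact _).2 ⟨a, rfl⟩
  have hact : ∀ (v : e) (a : h), ⁅v, i a⁆ = i (ψ (p v) a) := by
    intro v a
    obtain ⟨b, hb⟩ := (hexact (v - s (p v))).1 (by rw [map_sub, hs, sub_self])
    calc ⁅v, i a⁆ = ⁅i b + s (p v), i a⁆ := by rw [hb, sub_add_cancel]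
      _ = i (ψ (p v) a) := by rw [add_lie, habelian, haction, zero_add]
  have hact' : ∀ (v : e) (a : h), ⁅i a, v⁆ = -i (ψ (p v) a) := by
    intro v a
    rw [← lie_skew, hact]
  refine ⟨fun v => v + i (d (p v)), ?_, ?_, ?_, ?_, ?_, ?_, ?_, ?_⟩
  · intro a x
    simp only [map_add, hpi, hs, zero_add]
    abel
  · intro u v
    simp only [map_add]
    abel
  · intro c v
    simp only [map_smul, smul_add]
  · refine Function.bijective_iff_has_inverse.2 ⟨fun v => v - i (d (p v)), ?_, ?_⟩
    · intro v
      simp only [map_add, hpi, add_zero, add_sub_cancel_right]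
    · intro v
      simp only [map_sub, hpi, sub_zero, sub_add_cancel]
  · intro u v
    simp only [LieHom.map_lie, hd1, map_sub, add_lie, lie_add, hact, hact', map_add, hpi,
      add_zero]
    abel
  · intro v
    simp only [map_add, hiU, hd2, hpU]
  · intro a
    simp only [hpi, map_zero, add_zero]
  · intro x
    simp only [map_add, hpi, hs, add_zero]
end
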